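/- arXiv:1208.1954 — 2 statements merged into one kernel-verified Lean document; each statement's English description precedes it below -/
import Mathlib

section
/- Let (X,d,μ) be a metric measure space and 0 < δ < 1. Then the snowflaked space (X, d^δ, μ) is a Lipschitz differentiability space if and only if μ(X) = 0. -/
open MeasureTheory Metric Filter Set Topology
open scoped ENNReal NNReal

noncomputable section

/-- The euclidean dot product on `ℝⁿ`. -/
def euclDot {n : ℕ} (a b : EuclideanSpace ℝ (Fin n)) : ℝ := ∑ i, a i * b i

/-- `f` admits `D` as a derivative at `x₀` with respect to the chart map `φ`:
`|f x - f x₀ - D·(φ x - φ x₀)| / d(x,x₀) → 0` as `x → x₀`. -/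
def DiffAt {X : Type*} [MetricSpace X] {n : ℕ} (f : X → ℝ)
    (φ : X → EuclideanSpace ℝ (Fin n)) (x₀ : X) (D : EuclideanSpace ℝ (Fin n)) : Prop :=
  Tendsto (fun x => |f x - f x₀ - euclDot D (φ x - φ x₀)| / dist x x₀) (𝓝[≠] x₀) (𝓝 0)

/-- A metric measure space is a Lipschitz differentiability space if it admits a countable
Borel decomposition into charts with respect to which every real-valued Lipschitz function is
differentiable almost everywhere. -/
def IsLDS (X : Type*) [MetricSpace X] [MeasurableSpace X] (μ : Measure X) : Prop :=
  ∃ (n : ℕ → ℕ) (U : ℕ → Set X) (φ : ∀ i, X → EuclideanSpace ℝ (Fin (n i))),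
    (∀ i, MeasurableSet (U i)) ∧ (⋃ i, U i) = univ ∧
    (∀ i, ∃ K : ℝ≥0, LipschitzWith K (φ i)) ∧
    ∀ f : X → ℝ, (∃ K : ℝ≥0, LipschitzWith K f) →
      ∀ i, ∀ᵐ x ∂(μ.restrict (U i)), ∃! D, DiffAt f (φ i) x D

end

noncomputable section

/-- The snowflaked metric `d^δ` on `X`, for `0 < δ ≤ 1`. -/
def snowflakeMetric (X : Type*) [MetricSpace X] (δ : ℝ) (h0 : 0 < δ) (h1 : δ ≤ 1) :
    MetricSpace X where
  dist x y := dist x y ^ δ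
  dist_self x := by simp [Real.zero_rpow h0.ne']
  dist_comm x y := congrArg (· ^ δ) (dist_comm x y)
  dist_triangle x y z := by
    have h2 : dist x z ^ δ ≤ (dist x y + dist y z) ^ δ :=
      Real.rpow_le_rpow dist_nonneg (dist_triangle x y z) h0.le
    refine h2.trans ?_
    have h3 := NNReal.rpow_add_le_add_rpow (Real.toNNReal (dist x y))
      (Real.toNNReal (dist y z)) h0.le h1
    have h4 : ((Real.toNNReal (dist x y) + Real.toNNReal (dist y z) : ℝ≥0) : ℝ) ^ δ
        ≤ ((Real.toNNReal (dist x y) : ℝ≥0) : ℝ) ^ δ + ((Real.toNNReal (dist y z) : ℝ≥0) : ℝ) ^ δ := by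
      rw [← NNReal.coe_rpow, ← NNReal.coe_rpow, ← NNReal.coe_rpow, ← NNReal.coe_add]
      exact_mod_cast h3
    simpa [Real.coe_toNNReal _ dist_nonneg] using h4
  eq_of_dist_eq_zero := by
    intro x y h
    exact eq_of_dist_eq_zero ((Real.rpow_eq_zero dist_nonneg h0.ne').mp h)

end


lemma flat_aux {X : Type*} [MetricSpace X] (δ : ℝ) (h0 : 0 < δ) (h1 : δ < 1)
    (f : X → ℝ) (hf : ∀ x y, |f x - f y| ≤ dist x y ^ δ) (ε : ℝ) (hε : 0 < ε) :
    ∃ g : X → ℝ, (∀ x y, |g x - g y| ≤ dist x y ^ δ) ∧ (∀ x, |f x - g x| ≤ ε) ∧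
      ∀ η > 0, ∃ r > 0, ∀ x y, dist x y ^ δ ≤ r → |g x - g y| ≤ η * dist x y ^ δ := by
  set t0 : ℝ := ε ^ (1 / δ) with ht0
  have ht0p : 0 < t0 := Real.rpow_pos_of_pos hε _
  have ht0d : t0 ^ δ = ε := by
    rw [ht0, ← Real.rpow_mul hε.le]; field_simp; simp
  set M : ℝ := t0 ^ (δ - 1) with hM
  have hMp : 0 < M := Real.rpow_pos_of_pos ht0p _
  -- facts about powers
  have pw : ∀ t : ℝ, 0 < t → t ^ δ = t * t ^ (δ - 1) := by
    intro t ht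
    rw [Real.rpow_sub_one ht.ne']; field_simp
  have anti : ∀ a b : ℝ, 0 < a → a ≤ b → b ^ (δ - 1) ≤ a ^ (δ - 1) := fun a b ha hab =>
    Real.rpow_le_rpow_of_nonpos ha hab (by linarith)
  have big : ∀ t : ℝ, 0 ≤ t → M * t < t ^ δ → t < t0 := by
    intro t ht h
    by_contra hlt
    push Not at hlt
    have htp : 0 < t := lt_of_lt_of_le ht0p hlt
    have := anti t0 t ht0p hlt
    rw [pw t htp] at h
    nlinarith
  have small : ∀ t : ℝ, 0 < t → t ^ δ ≤ M * t → t ^ (δ - 1) ≤ M := by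
    intro t ht h
    rw [pw t ht, mul_comm] at h
    exact le_of_mul_le_mul_right h ht
  let ω : ℝ → ℝ := fun t => min (t ^ δ) (M * t)
  have ω0 : ω 0 = 0 := by simp [ω, Real.zero_rpow h0.ne']
  have ωnn : ∀ t, 0 ≤ t → 0 ≤ ω t := fun t ht =>
    le_min (Real.rpow_nonneg ht _) (mul_nonneg hMp.le ht)
  have ωmono : ∀ a b, 0 ≤ a → a ≤ b → ω a ≤ ω b := fun a b ha hab =>
    min_le_min (Real.rpow_le_rpow ha hab h0.le) (by gcongr)
  have mixed : ∀ a b : ℝ, 0 ≤ a → 0 ≤ b → a ^ δ ≤ M * a → (a + b) ^ δ ≤ a ^ δ + M * b ∨ a = 0 := by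
    intro a b ha hb h
    rcases ha.eq_or_lt with h' | h'
    · right; exact h'.symm
    · left
      have e1 := small a h' h
      have e2 := anti a (a + b) h' (by linarith)
      rw [pw (a + b) (by linarith), pw a h']
      nlinarith
  have ωsub : ∀ a b, 0 ≤ a → 0 ≤ b → ω (a + b) ≤ ω a + ω b := by
    intro a b ha hb
    have sub : (a + b) ^ δ ≤ a ^ δ + b ^ δ := Real.rpow_add_le_add_rpow ha hb h0.le h1.le
    rcases le_total (a ^ δ) (M * a) with h | h <;> rcases le_total (b ^ δ) (M * b) with h' | h'
    · simp only [ω, min_eq_left h, min_eq_left h']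
      exact (min_le_left _ _).trans sub
    · rcases mixed a b ha hb h with h2 | h2
      · simp only [ω, min_eq_left h, min_eq_right h']
        exact (min_le_left _ _).trans h2
      · rw [h2, ω0]; simp
    · rcases mixed b a hb ha h' with h2 | h2
      · simp only [ω, min_eq_right h, min_eq_left h']
        rw [add_comm b a] at h2
        exact (min_le_left _ _).trans (by linarith)
      · rw [h2, ω0]; simp
    · simp only [ω, min_eq_right h, min_eq_right h']
      exact (min_le_right _ _).trans (by linarith)
  have ωapp : ∀ t, 0 ≤ t → t ^ δ ≤ ω t + ε := by
    intro t ht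
    rcases le_or_gt (t ^ δ) (M * t) with h | h
    · simp only [ω, min_eq_left h]; linarith
    · have := big t ht h
      have h3 : t ^ δ ≤ t0 ^ δ := Real.rpow_le_rpow ht this.le h0.le
      have := ωnn t ht
      linarith
  have key : ∀ x y, f x - ε ≤ f y + ω (dist x y) := by
    intro x y
    have := (abs_le.1 (hf x y)).2
    have := ωapp (dist x y) dist_nonneg
    linarith
  have bdd : ∀ x, BddBelow (range fun y => f y + ω (dist x y)) := by
    intro x
    refine ⟨f x - ε, ?_⟩
    rintro _ ⟨y, rfl⟩
    exact key x y
  let g : X → ℝ := fun x => ⨅ y, (f y + ω (dist x y))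
  have half : ∀ x y, g x ≤ g y + ω (dist x y) := by
    intro x y
    have : Nonempty X := ⟨x⟩
    rw [← sub_le_iff_le_add]
    refine le_ciInf fun z => ?_
    have e1 : g x ≤ f z + ω (dist x z) := ciInf_le (bdd x) z
    have e2 := ωsub (dist x y) (dist y z) dist_nonneg dist_nonneg
    have e3 := ωmono _ _ dist_nonneg (dist_triangle x y z)
    linarith
  have gω : ∀ x y, |g x - g y| ≤ ω (dist x y) := by
    intro x y
    rw [abs_le]
    have e1 := half x y
    have e2 := half y x
    rw [dist_comm y x] at e2
    constructor <;> linarith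
  refine ⟨g, fun x y => (gω x y).trans (min_le_left _ _), ?_, ?_⟩
  · intro x
    have : Nonempty X := ⟨x⟩
    have e1 : g x ≤ f x + ω (dist x x) := ciInf_le (bdd x) x
    have e2 : f x - ε ≤ g x := le_ciInf fun y => key x y
    rw [dist_self, ω0] at e1
    rw [abs_le]; constructor <;> linarith
  · intro η hη
    set d0 : ℝ := (η / M) ^ (1 / (1 - δ)) with hd0
    have hd0p : 0 < d0 := Real.rpow_pos_of_pos (div_pos hη hMp) _
    have h1' : 0 < 1 - δ := by linarith
    have hd0e : d0 ^ (1 - δ) = η / M := by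
      rw [hd0, ← Real.rpow_mul (div_pos hη hMp).le, one_div, inv_mul_cancel₀ h1'.ne', Real.rpow_one]
    refine ⟨d0 ^ δ, Real.rpow_pos_of_pos hd0p _, fun x y hxy => ?_⟩
    have hle : dist x y ≤ d0 := (Real.rpow_le_rpow_iff dist_nonneg hd0p.le h0).1 hxy
    refine (gω x y).trans ((min_le_right _ _).trans ?_)
    have e1 : dist x y ^ (1 - δ) ≤ η / M := hd0e ▸ Real.rpow_le_rpow dist_nonneg hle h1'.le
    have e2 : dist x y = dist x y ^ (1 - δ) * dist x y ^ δ := by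
      rw [← Real.rpow_add_of_nonneg dist_nonneg h1'.le h0.le]; simp
    calc M * dist x y = M * (dist x y ^ (1 - δ) * dist x y ^ δ) := by rw [← e2]
      _ ≤ M * (η / M * dist x y ^ δ) := by gcongr
      _ = η * dist x y ^ δ := by field_simp

/-- uniformly flat approximability of Lipschitz functions -/
def FlatApprox (X : Type*) [MetricSpace X] : Prop :=
  ∀ f : X → ℝ, (∀ x y, |f x - f y| ≤ dist x y) → ∀ ε > 0,
    ∃ g : X → ℝ, (∀ x y, |g x - g y| ≤ dist x y) ∧ (∀ x, |f x - g x| ≤ ε) ∧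
      ∀ η > 0, ∃ r > 0, ∀ x y, dist x y ≤ r → |g x - g y| ≤ η * dist x y

lemma construct {X : Type*} [MetricSpace X] (hflat : FlatApprox X)
    (T : ℕ → ℝ → ℝ → (X → ℝ) → Prop)
    (hT : ∀ j, ∀ t > 0, ∀ κ > 0, ∃ s t' h, 0 < s ∧ 0 < t' ∧ t' ≤ t ∧
      (∀ x y, |h x - h y| ≤ dist x y) ∧ (∀ x, |h x| ≤ κ) ∧ T j s t' h) :
    ∃ f : X → ℝ, (∀ x y, |f x - f y| ≤ dist x y) ∧ ∀ j : ℕ, ∃ s t h, 0 < s ∧ 0 < t ∧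
      t ≤ 1 / ((j : ℝ) + 1) ∧ T j s t h ∧
      ∀ x y, s ≤ dist x y → dist x y ≤ t →
        |(f x - f y) - (h x - h y)| ≤ 1 / ((j : ℝ) + 1) * dist x y := by
  let F : Set (BoundedContinuousFunction X ℝ) := {f | ∀ x y, |f x - f y| ≤ dist x y}
  have hF : IsClosed F := by
    simp only [F, ofPred_forall]
    refine isClosed_iInter fun x => isClosed_iInter fun y => ?_
    refine isClosed_le ?_ continuous_const
    have hev : ∀ z : X, Continuous fun f : BoundedContinuousFunction X ℝ => f z := fun z =>
      (BoundedContinuousFunction.lipschitz_eval_const z).continuous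
    exact ((hev x).sub (hev y)).abs
  have : CompleteSpace F := hF.completeSpace_coe
  let O : ℕ → Set F := fun j => {f | ∃ s t h, 0 < s ∧ 0 < t ∧
      t ≤ 1 / ((j : ℝ) + 1) ∧ T j s t h ∧ ∃ f0 : X → ℝ,
      (∀ x y, s ≤ dist x y → dist x y ≤ t →
        |(f0 x - f0 y) - (h x - h y)| ≤ 1 / (2 * ((j : ℝ) + 1)) * dist x y) ∧
      ∃ b, (∀ x, |f.1 x - f0 x| ≤ b) ∧ b < s / (4 * ((j : ℝ) + 1))}
  have hopen : ∀ j, IsOpen (O j) := by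
    intro j
    rw [Metric.isOpen_iff]
    rintro f ⟨s, t, h, hs, ht, htj, hTj, f0, hf0, b, hb, hbs⟩
    refine ⟨s / (4 * ((j : ℝ) + 1)) - b, by linarith, ?_⟩
    intro f' hf'
    rw [Metric.mem_ball] at hf'
    refine ⟨s, t, h, hs, ht, htj, hTj, f0, hf0, dist f' f + b, ?_, by linarith⟩
    intro x
    have e1 : |f'.1 x - f.1 x| ≤ dist f' f := by
      have := BoundedContinuousFunction.dist_coe_le_dist (f := f'.1) (g := f.1) x
      rw [Real.dist_eq] at this
      exact this
    have e2 := hb x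
    have e3 : f'.1 x - f0 x = (f'.1 x - f.1 x) + (f.1 x - f0 x) := by ring
    rw [e3]
    exact (abs_add_le _ _).trans (by linarith)
  have hdense : ∀ j, Dense (O j) := by
    intro j
    rw [Metric.dense_iff]
    intro f ε hε
    have hj : (0 : ℝ) < (j : ℝ) + 1 := by positivity
    obtain ⟨g, hgL, hgε, hgflat⟩ := hflat f.1 f.2 (ε / 4) (by positivity)
    set B : ℝ := ‖f.1‖ + ε / 4 with hB
    have hBp : 0 < B := by positivity
    have hgB : ∀ x, |g x| ≤ B := by
      intro x
      have e1 : |f.1 x| ≤ ‖f.1‖ := f.1.norm_coe_le_norm x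
      have e2 := hgε x
      have e3 : g x = f.1 x - (f.1 x - g x) := by ring
      rw [e3]
      exact (abs_sub _ _).trans (by linarith)
    set η : ℝ := min (1 / (4 * ((j : ℝ) + 1))) (ε / 4 / B) with hη
    have hηp : 0 < η := by positivity
    have hη1 : η ≤ 1 / (4 * ((j : ℝ) + 1)) := min_le_left _ _
    have hη2 : η * B ≤ ε / 4 := by
      rw [← le_div_iff₀ hBp]; exact min_le_right _ _
    obtain ⟨r, hr, hgr⟩ := hgflat η hηp
    obtain ⟨s, t, h, hs, ht, htr, hhL, hhκ, hTj⟩ := hT j (min r (1 / ((j : ℝ) + 1))) (by positivity)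
      (min (ε / 8) (η * r / 2)) (by positivity)
    have hL : ∀ x y, |(g x + h x) - (g y + h y)| ≤ (1 + η) * dist x y := by
      intro x y
      have e0 : (g x + h x) - (g y + h y) = (g x - g y) + (h x - h y) := by ring
      rw [e0]
      refine (abs_add_le _ _).trans ?_
      rcases le_total (dist x y) r with hd | hd
      · have := hgr x y hd
        have := hhL x y
        linarith
      · have := hgL x y
        have e1 := (hhκ x).trans (min_le_right _ _)
        have e2 := (hhκ y).trans (min_le_right _ _)
        have e3 := abs_sub (h x) (h y)
        nlinarith
    have h1η : 0 < 1 + η := by linarith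
    let f0 : X → ℝ := fun x => (g x + h x) / (1 + η)
    have hf0L : ∀ x y, |f0 x - f0 y| ≤ dist x y := by
      intro x y
      simp only [f0]
      rw [← sub_div, abs_div, abs_of_pos h1η, div_le_iff₀ h1η]
      linarith [hL x y]
    have hf0c : Continuous f0 := by
      have : LipschitzWith 1 f0 := LipschitzWith.of_dist_le_mul (fun x y => by
        simpa [Real.dist_eq] using hf0L x y)
      exact this.continuous
    have hf0d : ∀ x, |f0 x - f.1 x| ≤ 3 * ε / 4 := by
      intro x
      have e0 : f0 x - f.1 x = (h x - η * g x) / (1 + η) - (f.1 x - g x) := by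
        simp only [f0]; field_simp; ring
      rw [e0]
      refine (abs_sub _ _).trans ?_
      have e1 : |(h x - η * g x) / (1 + η)| ≤ |h x - η * g x| := by
        rw [abs_div, abs_of_pos h1η]
        exact div_le_self (abs_nonneg _) (by linarith)
      have e2 : |h x - η * g x| ≤ |h x| + η * |g x| := by
        refine (abs_sub _ _).trans ?_
        rw [abs_mul, abs_of_pos hηp]
      have e3 := (hhκ x).trans (min_le_left _ _)
      have e4 : η * |g x| ≤ η * B := by gcongr; exact hgB x
      linarith [hgε x]
    let f0b : BoundedContinuousFunction X ℝ := BoundedContinuousFunction.ofNormedAddCommGroup f0 hf0c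
      (‖f.1‖ + 3 * ε / 4) (by
        intro x
        have e1 : |f.1 x| ≤ ‖f.1‖ := f.1.norm_coe_le_norm x
        have e2 := hf0d x
        have e3 : f0 x = f.1 x + (f0 x - f.1 x) := by ring
        rw [Real.norm_eq_abs, e3]
        exact (abs_add_le _ _).trans (by linarith))
    refine ⟨⟨f0b, hf0L⟩, ?_, ?_⟩
    · rw [Metric.mem_ball, Subtype.dist_eq]
      have hlt : 3 * ε / 4 < ε := by linarith
      refine lt_of_le_of_lt ((BoundedContinuousFunction.dist_le (by positivity)).2 ?_) hlt
      intro x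
      rw [Real.dist_eq]
      exact hf0d x
    · refine ⟨s, t, h, hs, ht, htr.trans (min_le_right _ _), hTj, f0, ?_, 0, ?_, by positivity⟩
      · intro x y _ hxy
        have e0 : (f0 x - f0 y) - (h x - h y) = ((g x - g y) - η * (h x - h y)) / (1 + η) := by
          simp only [f0]; field_simp; ring
        rw [e0, abs_div, abs_of_pos h1η]
        refine (div_le_self (abs_nonneg _) (by linarith)).trans ?_
        refine (abs_sub _ _).trans ?_
        rw [abs_mul, abs_of_pos hηp]
        have e1 := hgr x y (hxy.trans (htr.trans (min_le_left _ _)))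
        have e2 : η * |h x - h y| ≤ η * dist x y := by gcongr; exact hhL x y
        have e3 : η * dist x y ≤ 1 / (4 * ((j : ℝ) + 1)) * dist x y := by gcongr
        have e4 : 1 / (2 * ((j : ℝ) + 1)) * dist x y = 2 * (1 / (4 * ((j : ℝ) + 1)) * dist x y) := by
          field_simp; ring
        rw [e4]; linarith
      · intro x
        change |f0 x - f0 x| ≤ 0
        simp
  have hD := dense_iInter_of_isOpen_nat hopen hdense
  have : Nonempty F := ⟨⟨0, fun x y => by simp⟩⟩
  obtain ⟨f, hf⟩ := hD.nonempty
  rw [mem_iInter] at hf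
  refine ⟨f.1, f.2, fun j => ?_⟩
  obtain ⟨s, t, h, hs, ht, htj, hTj, f0, hf0, b, hb, hbs⟩ := hf j
  refine ⟨s, t, h, hs, ht, htj, hTj, fun x y hsx hxt => ?_⟩
  have e0 : (f.1 x - f.1 y) - (h x - h y) =
      ((f.1 x - f0 x) - (f.1 y - f0 y)) + ((f0 x - f0 y) - (h x - h y)) := by ring
  rw [e0]
  refine (abs_add_le _ _).trans ?_
  have e1 := abs_sub (f.1 x - f0 x) (f.1 y - f0 y)
  have e2 := hb x
  have e3 := hb y
  have e4 := hf0 x y hsx hxt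
  have hj : (0 : ℝ) < (j : ℝ) + 1 := by positivity
  have e5 : s / (4 * ((j : ℝ) + 1)) ≤ 1 / (4 * ((j : ℝ) + 1)) * dist x y := by
    rw [div_mul_eq_mul_div, one_mul]; gcongr
  have e6 : 1 / ((j : ℝ) + 1) * dist x y = 4 * (1 / (4 * ((j : ℝ) + 1)) * dist x y) := by
    field_simp
  have e7 : 1 / (2 * ((j : ℝ) + 1)) * dist x y = 2 * (1 / (4 * ((j : ℝ) + 1)) * dist x y) := by
    field_simp; ring
  rw [e6]; rw [e7] at e4
  linarith

lemma small_compl {X : Type*} [MeasurableSpace X] (μ : Measure X) [IsFiniteMeasure μ]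
    (V : Set X) (hV : MeasurableSet V) (A : ℕ → Set X) (hA : ∀ m, MeasurableSet (A m))
    (hmono : Monotone A) (hcov : μ (V \ ⋃ m, A m) = 0) (ε : ℝ≥0∞) (hε : 0 < ε) :
    ∃ m, μ (V \ A m) < ε := by
  have h := tendsto_measure_iInter_atTop (μ := μ) (s := fun m => V \ A m)
    (fun m => (hV.diff (hA m)).nullMeasurableSet)
    (fun m k hmk => sdiff_subset_sdiff_right (hmono hmk)) ⟨0, measure_ne_top _ _⟩
  rw [← sdiff_iUnion, hcov] at h
  exact (h.eventually (gt_mem_nhds hε)).exists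

lemma euclDot_eq {n : ℕ} (a b : EuclideanSpace ℝ (Fin n)) : euclDot a b = inner ℝ a b := by
  simp [euclDot, PiLp.inner_apply, mul_comm]

lemma diffAt_iff {X : Type*} [MetricSpace X] {n : ℕ} (f : X → ℝ)
    (φ : X → EuclideanSpace ℝ (Fin n)) (x : X) (D : EuclideanSpace ℝ (Fin n)) :
    DiffAt f φ x D ↔ ∀ ε > 0, ∃ r > 0, ∀ y, 0 < dist x y → dist x y < r →
      |f x - f y - inner ℝ D (φ x - φ y)| ≤ ε * dist x y := by
  have hs : ∀ y, |f y - f x - euclDot D (φ y - φ x)| = |f x - f y - inner ℝ D (φ x - φ y)| := by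
    intro y
    rw [euclDot_eq, ← abs_neg, inner_sub_right, inner_sub_right]
    congr 1; ring
  unfold DiffAt
  rw [Metric.tendsto_nhdsWithin_nhds]
  constructor
  · intro h ε hε
    obtain ⟨r, hr, h⟩ := h ε hε
    refine ⟨r, hr, fun y hy hyr => ?_⟩
    have hne : y ≠ x := fun h' => by simp [h'] at hy
    have := h hne (by rwa [dist_comm])
    rw [Real.dist_eq, sub_zero, abs_div, abs_abs, hs, dist_comm y x, abs_of_pos hy,
      div_lt_iff₀ hy] at this
    exact this.le
  · intro h ε hε
    obtain ⟨r, hr, h⟩ := h (ε / 2) (by positivity)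
    refine ⟨r, hr, fun y hne hyr => ?_⟩
    have hy : 0 < dist x y := dist_pos.2 (Ne.symm hne)
    have := h y hy (by rwa [dist_comm])
    rw [Real.dist_eq, sub_zero, abs_div, abs_abs, hs, dist_comm y x, abs_of_pos hy,
      div_lt_iff₀ hy]
    nlinarith

lemma tsum_half_ne_top : ∑' j : ℕ, (2⁻¹ : ℝ≥0∞) ^ j ≠ ∞ := by
  rw [ENNReal.tsum_geometric]
  simp

lemma exists_of_ae_restrict {X : Type*} [MeasurableSpace X] (μ : Measure X) (V : Set X)
    (hV : MeasurableSet V) (hne : μ V ≠ 0) (P : X → Prop) (h : ∀ᵐ x ∂(μ.restrict V), P x) :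
    ∃ x ∈ V, P x := by
  by_contra hcon
  push Not at hcon
  apply hne
  rw [ae_restrict_iff' hV] at h
  refine measure_mono_null ?_ h
  intro x hx hx'
  exact hcon x hx (hx' hx)

lemma case_zero {X : Type*} [MetricSpace X] [TopologicalSpace.SeparableSpace X]
    [MeasurableSpace X] [BorelSpace X] (μ : Measure X) [IsFiniteMeasure μ]
    (hflat : FlatApprox X)
    (hiso : μ {x : X | 𝓝[≠] x = ⊥} = 0) (V : Set X) (hVm : MeasurableSet V)
    (hV : ∀ f : X → ℝ, (∀ x y, |f x - f y| ≤ dist x y) → ∀ᵐ x ∂(μ.restrict V),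
      ∀ ε > 0, ∃ r > 0, ∀ y, 0 < dist x y → dist x y < r → |f x - f y| ≤ ε * dist x y) :
    μ V = 0 := by
  by_contra hne
  -- no atoms
  have hatom : ∀ p ∈ V, μ {p} = 0 := by
    intro p hp
    by_contra hpne
    have h1 := hV (fun x => dist x p) (fun x y => abs_dist_sub_le x y p)
    have hp' : MeasurableSet ({p} : Set X) := measurableSet_singleton p
    have h2 : ∀ᵐ x ∂(μ.restrict {p}), ∀ ε > 0, ∃ r > 0, ∀ y, 0 < dist x y → dist x y < r →
        |dist x p - dist y p| ≤ ε * dist x y :=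
      ae_restrict_of_ae_restrict_of_subset (singleton_subset_iff.2 hp) h1
    have h3 : ∀ᵐ x ∂(μ.restrict {p}), ¬ (𝓝[≠] x = ⊥) := by
      apply ae_restrict_of_ae
      rw [ae_iff]
      simpa using hiso
    obtain ⟨x, hx, h4, h5⟩ := exists_of_ae_restrict μ {p} hp' hpne _ (h2.and h3)
    rw [mem_singleton_iff] at hx
    subst hx
    obtain ⟨r, hr, h6⟩ := h4 (1 / 2) (by norm_num)
    have : NeBot (𝓝[≠] x) := ⟨h5⟩
    have h7 : ∀ᶠ y in 𝓝[≠] x, y ∈ ball x r := nhdsWithin_le_nhds (ball_mem_nhds x hr)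
    obtain ⟨y, hy, hyx⟩ := (h7.and (eventually_mem_nhdsWithin)).exists
    have hd : 0 < dist x y := dist_pos.2 (Ne.symm hyx)
    have h8 := h6 y hd (by rwa [dist_comm])
    rw [dist_self, zero_sub, abs_neg, dist_comm y x, abs_of_pos hd] at h8
    linarith
  obtain ⟨x0, hx0⟩ : V.Nonempty := nonempty_of_measure_ne_zero hne
  have : Nonempty X := ⟨x0⟩
  let G : ℝ → ℝ → (X → ℝ) → Set X := fun s t h =>
    {x | ∃ y, s ≤ dist x y ∧ dist x y ≤ t ∧ dist x y ≤ |h x - h y|}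
  obtain ⟨f, hfL, hf⟩ := construct hflat (fun j s t h => μ (V \ G s t h) ≤ 2⁻¹ ^ j) (by
    intro j t ht κ hκ
    have hε : (0 : ℝ≥0∞) < 2⁻¹ ^ j / 2 := by
      apply ENNReal.div_pos
      · exact pow_ne_zero _ (by simp)
      · simp
    set κ' := min κ t with hκ'
    have hκ'p : 0 < κ' := by positivity
    let N : ℕ → Set X := fun m => TopologicalSpace.denseSeq X '' (Iic m)
    have hNne : ∀ m, (N m).Nonempty := fun m => ⟨_, mem_image_of_mem _ (mem_Iic.2 le_rfl)⟩
    have hNfin : ∀ m, (N m).Finite := fun m => (finite_Iic m).image _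
    have hcont : ∀ m, Continuous fun x => infDist x (N m) := fun m => continuous_infDist_pt _
    obtain ⟨m, hm⟩ := small_compl μ V hVm (fun m => {x | infDist x (N m) < κ'})
      (fun m => (isOpen_lt (hcont m) continuous_const).measurableSet)
      (by
        intro m k hmk x hx
        exact lt_of_le_of_lt (infDist_le_infDist_of_subset
          (image_mono (Iic_subset_Iic.2 hmk)) (hNne m)) hx)
      (by
        convert measure_empty (μ := μ)
        rw [sdiff_eq_empty]
        intro x _
        obtain ⟨m, hm⟩ := (TopologicalSpace.denseRange_denseSeq X).exists_dist_lt x hκ'p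
        refine mem_iUnion.2 ⟨m, ?_⟩
        exact lt_of_le_of_lt (infDist_le_dist_of_mem (mem_image_of_mem _ (mem_Iic.2 le_rfl))) hm)
      _ hε
    obtain ⟨i, hi⟩ := small_compl μ V hVm (fun i : ℕ => {x | 1 / ((i : ℝ) + 1) < infDist x (N m)})
      (fun i => (isOpen_lt continuous_const (hcont m)).measurableSet)
      (by
        intro i k hik x hx
        change 1 / ((i : ℝ) + 1) < infDist x (N m) at hx
        change 1 / ((k : ℝ) + 1) < infDist x (N m)
        exact lt_of_le_of_lt (Nat.one_div_le_one_div hik) hx)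
      (by
        have hz : μ (V ∩ N m) = 0 := by
          rw [← biUnion_of_singleton (V ∩ N m)]
          rw [measure_biUnion_null_iff ((hNfin m).inter_of_right V).countable]
          exact fun p hp => hatom p hp.1
        refine measure_mono_null ?_ hz
        rintro x ⟨hxV, hx⟩
        refine ⟨hxV, ?_⟩
        rw [(hNfin m).isClosed.mem_iff_infDist_zero (hNne m)]
        by_contra hpos
        apply hx
        obtain ⟨i, hi⟩ := exists_nat_one_div_lt (lt_of_le_of_ne infDist_nonneg (Ne.symm hpos))
        exact mem_iUnion.2 ⟨i, hi⟩)
      _ hε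
    refine ⟨1 / ((i : ℝ) + 1), t, fun x => min κ' (infDist x (N m)), by positivity, ht, le_rfl,
      ?_, ?_, ?_⟩
    · intro x y
      have h1 : |infDist x (N m) - infDist y (N m)| ≤ dist x y := by
        have := (lipschitz_infDist_pt (N m)).dist_le_mul x y
        simpa [Real.dist_eq] using this
      refine le_trans ?_ h1
      have := abs_min_sub_min_le_max κ' (infDist x (N m)) κ' (infDist y (N m))
      simpa using this
    · intro x
      rw [abs_of_nonneg (le_min hκ'p.le infDist_nonneg)]
      exact (min_le_left _ _).trans (min_le_left _ _)
    · calc μ (V \ G _ t _) ≤ μ ((V \ {x | infDist x (N m) < κ'}) ∪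
            (V \ {x | 1 / ((i : ℝ) + 1) < infDist x (N m)})) := by
            apply measure_mono
            rintro x ⟨hxV, hxG⟩
            by_contra hcon
            apply hxG
            simp only [mem_union, Set.mem_sdiff, hxV, true_and, not_or, not_not] at hcon
            obtain ⟨h1, h2⟩ := hcon
            change infDist x (N m) < κ' at h1
            change 1 / ((i : ℝ) + 1) < infDist x (N m) at h2
            obtain ⟨y, hy, hxy⟩ := (hNfin m).isCompact.exists_infDist_eq_dist (hNne m) x
            refine ⟨y, ?_, ?_, ?_⟩
            · rw [← hxy]; exact h2.le
            · rw [← hxy]; exact h1.le.trans (min_le_right _ _)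
            · simp only [infDist_zero_of_mem hy, min_eq_right h1.le, min_eq_right hκ'p.le]
              rw [← hxy, sub_zero, abs_of_nonneg infDist_nonneg]
        _ ≤ 2⁻¹ ^ j / 2 + 2⁻¹ ^ j / 2 := (measure_union_le _ _).trans (add_le_add hm.le hi.le)
        _ = 2⁻¹ ^ j := ENNReal.add_halves _)
  choose s t h hs ht htj hTj hfh using hf
  have hBC : ∀ᵐ x ∂μ, ∀ᶠ j in atTop, x ∉ V \ G (s j) (t j) (h j) :=
    ae_eventually_notMem (ne_top_of_le_ne_top tsum_half_ne_top (ENNReal.tsum_le_tsum hTj))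
  obtain ⟨x, hxV, hx1, hx2⟩ := exists_of_ae_restrict μ V hVm hne _
    ((hV f hfL).and (ae_restrict_of_ae hBC))
  obtain ⟨r, hr, hxr⟩ := hx1 (1 / 4) (by norm_num)
  have hlim := tendsto_one_div_add_atTop_nhds_zero_nat (𝕜 := ℝ)
  obtain ⟨j, hj1, hj2, hj3⟩ := (hx2.and ((hlim.eventually (gt_mem_nhds hr)).and
    (hlim.eventually (gt_mem_nhds (show (0 : ℝ) < 1 / 2 by norm_num))))).exists
  have hxG : x ∈ G (s j) (t j) (h j) := by
    by_contra hcon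
    exact hj1 ⟨hxV, hcon⟩
  obtain ⟨y, hy1, hy2, hy3⟩ := hxG
  have hd : 0 < dist x y := lt_of_lt_of_le (hs j) hy1
  have e1 := hxr y hd (lt_of_le_of_lt (hy2.trans (htj j)) hj2)
  have e2 := hfh j x y hy1 hy2
  have e3 : 1 / ((j : ℝ) + 1) * dist x y ≤ 1 / 2 * dist x y := by gcongr
  have e4 : |h j x - h j y| ≤ |f x - f y| + |(f x - f y) - (h j x - h j y)| := by
    have := abs_sub (f x - f y) ((f x - f y) - (h j x - h j y))
    simpa using this
  linarith

/-- points at which `φ` spreads in all directions at some scale in `(s,t)` -/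
def Spread {X : Type*} [MetricSpace X] {n : ℕ} (φ : X → EuclideanSpace ℝ (Fin n))
    (c s t : ℝ) : Set X :=
  {x | ∀ l ∈ sphere (0 : EuclideanSpace ℝ (Fin n)) 1, ∃ y, s < dist x y ∧ dist x y < t ∧
    c * dist x y < |inner ℝ l (φ x - φ y)|}

lemma spread_mono {X : Type*} [MetricSpace X] {n : ℕ} (φ : X → EuclideanSpace ℝ (Fin n))
    {c c' s s' t t' : ℝ} (hc : c' ≤ c) (hs : s' ≤ s) (ht : t ≤ t') :
    Spread φ c s t ⊆ Spread φ c' s' t' := by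
  intro x hx l hl
  obtain ⟨y, h1, h2, h3⟩ := hx l hl
  refine ⟨y, lt_of_le_of_lt hs h1, lt_of_lt_of_le h2 ht, lt_of_le_of_lt ?_ h3⟩
  gcongr

lemma isOpen_spread {X : Type*} [MetricSpace X] {n : ℕ} (φ : X → EuclideanSpace ℝ (Fin n))
    (hφ : Continuous φ) (c s t : ℝ) : IsOpen (Spread φ c s t) := by
  rw [isOpen_iff_eventually]
  intro x hx
  refine (isCompact_sphere (0 : EuclideanSpace ℝ (Fin n)) 1).eventually_forall_of_forall_eventually
    (P := fun x l => ∃ y, s < dist x y ∧ dist x y < t ∧ c * dist x y < |inner ℝ l (φ x - φ y)|) ?_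
  intro l hl
  obtain ⟨y, h1, h2, h3⟩ := hx l hl
  have c1 : Continuous fun z : X × EuclideanSpace ℝ (Fin n) => dist z.1 y := by fun_prop
  have c2 : Continuous fun z : X × EuclideanSpace ℝ (Fin n) =>
      |(inner ℝ z.2 (φ z.1 - φ y) : ℝ)| := by fun_prop
  have c3 : Continuous fun z : X × EuclideanSpace ℝ (Fin n) => c * dist z.1 y := by fun_prop
  filter_upwards [(isOpen_lt continuous_const c1).mem_nhds (x := (x, l)) h1,
    (isOpen_lt c1 continuous_const).mem_nhds (x := (x, l)) h2,
    (isOpen_lt c3 c2).mem_nhds (x := (x, l)) h3] with z hz1 hz2 hz3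
  exact ⟨y, hz1, hz2, hz3⟩

lemma spread_of_unique {X : Type*} [MetricSpace X] {n : ℕ} (φ : X → EuclideanSpace ℝ (Fin n))
    (K : ℝ) (hK : 0 < K) (hφ : ∀ x y, ‖φ x - φ y‖ ≤ K * dist x y) (f : X → ℝ) (x : X)
    (hu : ∃! D, DiffAt f φ x D) :
    ∃ c > 0, ∀ t > 0, ∃ s > 0, x ∈ Spread φ c s t := by
  obtain ⟨D, hD, huniq⟩ := hu
  have step1 : ∀ l : EuclideanSpace ℝ (Fin n), l ≠ 0 → ∃ ε > 0, ∀ t > 0, ∃ y, 0 < dist x y ∧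
      dist x y < t ∧ ε * dist x y < |inner ℝ l (φ x - φ y)| := by
    intro l hl
    by_contra hcon
    push Not at hcon
    apply hl
    have : DiffAt f φ x (D + l) := by
      rw [diffAt_iff] at hD ⊢
      intro ε hε
      obtain ⟨r1, hr1, h1⟩ := hD (ε / 2) (by positivity)
      obtain ⟨r2, hr2, h2⟩ := hcon (ε / 2) (by positivity)
      refine ⟨min r1 r2, by positivity, fun y hy hyr => ?_⟩
      have e1 := h1 y hy (hyr.trans_le (min_le_left _ _))
      have e2 := h2 y hy (hyr.trans_le (min_le_right _ _))
      rw [inner_add_left, ← sub_sub]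
      exact (abs_sub _ _).trans (by linarith)
    simpa using huniq _ this
  have step2 : ∃ c > 0, ∀ l ∈ sphere (0 : EuclideanSpace ℝ (Fin n)) 1, ∀ t > 0, ∃ y, 0 < dist x y ∧
      dist x y < t ∧ c * dist x y < |inner ℝ l (φ x - φ y)| := by
    refine (isCompact_sphere (0 : EuclideanSpace ℝ (Fin n)) 1).induction_on
      (p := fun A => ∃ c > 0, ∀ l ∈ A, ∀ t > 0, ∃ y, 0 < dist x y ∧
        dist x y < t ∧ c * dist x y < |inner ℝ l (φ x - φ y)|) ?_ ?_ ?_ ?_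
    · exact ⟨1, one_pos, fun l hl => absurd hl (notMem_empty l)⟩
    · rintro A B hAB ⟨c, hc, h⟩
      exact ⟨c, hc, fun l hl => h l (hAB hl)⟩
    · rintro A B ⟨c, hc, h⟩ ⟨c', hc', h'⟩
      refine ⟨min c c', by positivity, ?_⟩
      rintro l (hl | hl) t ht
      · obtain ⟨y, h1, h2, h3⟩ := h l hl t ht
        refine ⟨y, h1, h2, lt_of_le_of_lt ?_ h3⟩
        gcongr; exact min_le_left _ _
      · obtain ⟨y, h1, h2, h3⟩ := h' l hl t ht
        refine ⟨y, h1, h2, lt_of_le_of_lt ?_ h3⟩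
        gcongr; exact min_le_right _ _
    · intro l hl
      have hl0 : l ≠ 0 := by
        rintro rfl
        simp at hl
      obtain ⟨ε, hε, h⟩ := step1 l hl0
      refine ⟨ball l (ε / (2 * K)), mem_nhdsWithin_of_mem_nhds (ball_mem_nhds _ (by positivity)),
        ε / 2, by positivity, fun l' hl' t ht => ?_⟩
      obtain ⟨y, h1, h2, h3⟩ := h t ht
      refine ⟨y, h1, h2, ?_⟩
      rw [mem_ball, dist_eq_norm] at hl'
      have e1 : |inner ℝ (l' - l) (φ x - φ y)| ≤ ε / (2 * K) * (K * dist x y) := by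
        refine (abs_real_inner_le_norm _ _).trans ?_
        gcongr
        exact hφ x y
      have e2 : ε / (2 * K) * (K * dist x y) = ε / 2 * dist x y := by field_simp
      rw [e2, inner_sub_left] at e1
      have e3 : |inner ℝ l (φ x - φ y)| ≤ |inner ℝ l' (φ x - φ y)| +
          |inner ℝ l' (φ x - φ y) - inner ℝ l (φ x - φ y)| := by
        have := abs_sub (inner ℝ l' (φ x - φ y))
          (inner ℝ l' (φ x - φ y) - inner ℝ l (φ x - φ y))
        simpa using this
      linarith
  obtain ⟨c, hc, h⟩ := step2
  refine ⟨c, hc, fun t ht => ?_⟩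
  refine (isCompact_sphere (0 : EuclideanSpace ℝ (Fin n)) 1).induction_on
      (p := fun A => ∃ s > 0, ∀ l ∈ A, ∃ y, s < dist x y ∧
        dist x y < t ∧ c * dist x y < |inner ℝ l (φ x - φ y)|) ?_ ?_ ?_ ?_
  · exact ⟨1, one_pos, fun l hl => absurd hl (notMem_empty l)⟩
  · rintro A B hAB ⟨s, hs, h⟩
    exact ⟨s, hs, fun l hl => h l (hAB hl)⟩
  · rintro A B ⟨s, hs, h⟩ ⟨s', hs', h'⟩
    refine ⟨min s s', by positivity, ?_⟩
    rintro l (hl | hl)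
    · obtain ⟨y, h1, h2, h3⟩ := h l hl
      exact ⟨y, lt_of_le_of_lt (min_le_left _ _) h1, h2, h3⟩
    · obtain ⟨y, h1, h2, h3⟩ := h' l hl
      exact ⟨y, lt_of_le_of_lt (min_le_right _ _) h1, h2, h3⟩
  · intro l hl
    obtain ⟨y, h1, h2, h3⟩ := h l hl t ht
    have c2 : Continuous fun z : EuclideanSpace ℝ (Fin n) =>
      |(inner ℝ z (φ x - φ y) : ℝ)| := by fun_prop
    refine ⟨{l' | c * dist x y < |inner ℝ l' (φ x - φ y)|},
      mem_nhdsWithin_of_mem_nhds ((isOpen_lt continuous_const c2).mem_nhds h3),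
      dist x y / 2, by positivity, fun l' hl' => ⟨y, by linarith, h2, hl'⟩⟩

lemma case_pos {X : Type*} [MetricSpace X]
    [MeasurableSpace X] [BorelSpace X] (μ : Measure X) [IsFiniteMeasure μ]
    (hflat : FlatApprox X) {n : ℕ} (i0 : Fin n) (φ : X → EuclideanSpace ℝ (Fin n))
    (K : ℝ) (hK : 0 < K) (hφ : ∀ x y, ‖φ x - φ y‖ ≤ K * dist x y)
    (U : Set X) (hUm : MeasurableSet U)
    (hU : ∀ f : X → ℝ, (∀ x y, |f x - f y| ≤ dist x y) → ∀ᵐ x ∂(μ.restrict U),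
      ∃! D, DiffAt f φ x D) :
    μ U = 0 := by
  by_contra hne
  have hφc : Continuous φ := by
    have : LipschitzWith (Real.toNNReal K) φ := LipschitzWith.of_dist_le_mul (fun x y => by
      rw [dist_eq_norm, Real.coe_toNNReal _ hK.le]; exact hφ x y)
    exact this.continuous
  let E : ℕ → Set X := fun m => ⋂ k : ℕ, ⋃ i : ℕ,
    Spread φ (1 / ((m : ℝ) + 1)) (1 / ((i : ℝ) + 1)) (1 / ((k : ℝ) + 1))
  have hEm : ∀ m, MeasurableSet (E m) := fun m => MeasurableSet.iInter fun k =>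
    MeasurableSet.iUnion fun i => (isOpen_spread φ hφc _ _ _).measurableSet
  obtain ⟨m, hm⟩ : ∃ m, μ (U ∩ E m) ≠ 0 := by
    by_contra hcon
    push Not at hcon
    apply hne
    have h1 : ∀ᵐ x ∂(μ.restrict U), x ∈ ⋃ m, E m := by
      filter_upwards [hU (fun _ => 0) (fun x y => by simp)] with x hx
      obtain ⟨c, hc, h⟩ := spread_of_unique φ K hK hφ _ x hx
      obtain ⟨m, hm⟩ := exists_nat_one_div_lt hc
      refine mem_iUnion.2 ⟨m, mem_iInter.2 fun k => ?_⟩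
      obtain ⟨s, hs, h⟩ := h (1 / ((k : ℝ) + 1)) (by positivity)
      obtain ⟨i, hi⟩ := exists_nat_one_div_lt hs
      exact mem_iUnion.2 ⟨i, spread_mono φ hm.le hi.le le_rfl h⟩
    rw [ae_restrict_iff' hUm] at h1
    have h2 : μ (⋃ m, U ∩ E m) = 0 := measure_iUnion_null hcon
    have h3 : U ⊆ (⋃ m, U ∩ E m) ∪ {x | ¬ (x ∈ U → x ∈ ⋃ m, E m)} := by
      intro x hx
      by_cases h : x ∈ ⋃ m, E m
      · left
        rw [← inter_iUnion]
        exact ⟨hx, h⟩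
      · right
        exact fun h' => h (h' hx)
    exact measure_mono_null h3 (measure_union_null h2 h1)
  set c : ℝ := 1 / ((m : ℝ) + 1) with hc
  have hcp : 0 < c := by positivity
  set V := U ∩ E m with hVdef
  have hVm : MeasurableSet V := hUm.inter (hEm m)
  have hG : ∀ t > 0, ∀ ε : ℝ≥0∞, 0 < ε → ∃ s > 0, μ (V \ Spread φ c s t) < ε := by
    intro t ht ε hε
    obtain ⟨k, hk⟩ := exists_nat_one_div_lt ht
    obtain ⟨i, hi⟩ := small_compl μ V hVm (fun i => Spread φ c (1 / ((i : ℝ) + 1)) t)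
      (fun i => (isOpen_spread φ hφc _ _ _).measurableSet)
      (fun i i' hii => spread_mono φ le_rfl (Nat.one_div_le_one_div hii) le_rfl)
      (by
        convert measure_empty (μ := μ)
        rw [sdiff_eq_empty]
        rintro x ⟨_, hx⟩
        obtain ⟨i, hi⟩ := mem_iUnion.1 (mem_iInter.1 hx k)
        exact mem_iUnion.2 ⟨i, spread_mono φ le_rfl le_rfl hk.le hi⟩)
      ε hε
    exact ⟨_, by positivity, hi⟩
  set a : ℝ := 1 / K with ha
  have hap : 0 < a := by positivity
  let e : EuclideanSpace ℝ (Fin n) := EuclideanSpace.single i0 1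
  have he : ‖e‖ = 1 := by simp [e]
  let g : X → ℝ := fun x => a * inner ℝ e (φ x)
  have hgL : ∀ x y, |g x - g y| ≤ dist x y := by
    intro x y
    have e0 : g x - g y = a * inner ℝ e (φ x - φ y) := by
      simp only [g, inner_sub_right]; ring
    rw [e0, abs_mul, abs_of_pos hap]
    have e1 := abs_real_inner_le_norm e (φ x - φ y)
    rw [he, one_mul] at e1
    calc a * |inner ℝ e (φ x - φ y)| ≤ a * (K * dist x y) := by
          gcongr; exact e1.trans (hφ x y)
      _ = dist x y := by rw [ha]; field_simp
  let θ : ℕ → ℝ := fun j => if Even j then 0 else 1 / 2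
  obtain ⟨f, hfL, hf⟩ := construct hflat (fun j s t h =>
      (∀ x y, s ≤ dist x y → dist x y ≤ t →
        |(h x - h y) - θ j * (g x - g y)| ≤ 1 / ((j : ℝ) + 1) * dist x y) ∧
      μ (V \ Spread φ c s t) ≤ 2⁻¹ ^ j) (by
    intro j t ht κ hκ
    have hε : (0 : ℝ≥0∞) < 2⁻¹ ^ j := pos_iff_ne_zero.2 (pow_ne_zero _ (by simp))
    by_cases hj : Even j
    · obtain ⟨s, hs, hsV⟩ := hG t ht _ hε
      refine ⟨s, t, fun _ => 0, hs, ht, le_rfl, fun x y => by simp, fun x => by simpa using hκ.le,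
        fun x y _ _ => ?_, hsV.le⟩
      simp only [θ, if_pos hj]
      simp only [sub_self, zero_mul, abs_zero]
      positivity
    · obtain ⟨g', hg'L, hg'κ, hg'flat⟩ := hflat g hgL κ hκ
      obtain ⟨r, hr, hr'⟩ := hg'flat (1 / ((j : ℝ) + 1)) (by positivity)
      obtain ⟨s, hs, hsV⟩ := hG (min r t) (by positivity) _ hε
      refine ⟨s, min r t, fun x => (g x - g' x) / 2, hs, by positivity, min_le_right _ _,
        fun x y => ?_, fun x => ?_, fun x y _ hxy => ?_, hsV.le⟩
      · have e0 : (g x - g' x) / 2 - (g y - g' y) / 2 = ((g x - g y) - (g' x - g' y)) / 2 := by ring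
        rw [e0, abs_div, abs_two]
        have := abs_sub (g x - g y) (g' x - g' y)
        linarith [hgL x y, hg'L x y]
      · rw [abs_div, abs_two]
        linarith [hg'κ x]
      · simp only [θ, if_neg hj]
        have e0 : (g x - g' x) / 2 - (g y - g' y) / 2 - 1 / 2 * (g x - g y)
          = - ((g' x - g' y) / 2) := by ring
        rw [e0, abs_neg, abs_div, abs_two]
        have e1 := hr' x y (hxy.trans (min_le_left _ _))
        have := abs_nonneg (g' x - g' y)
        linarith)
  choose s t h hs ht htj hTj hfh using hf
  have hBC : ∀ᵐ x ∂μ, ∀ᶠ j in atTop, x ∉ V \ Spread φ c (s j) (t j) :=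
    ae_eventually_notMem (ne_top_of_le_ne_top tsum_half_ne_top
      (ENNReal.tsum_le_tsum fun j => (hTj j).2))
  obtain ⟨x, hxV, hx1, hx2⟩ := exists_of_ae_restrict μ V hVm hm _
    ((ae_restrict_of_ae_restrict_of_subset inter_subset_left (hU f hfL)).and
      (ae_restrict_of_ae hBC))
  obtain ⟨D, hD, -⟩ := hx1
  rw [diffAt_iff] at hD
  set τ : ℝ := c * a / 16 with hτ
  have hτp : 0 < τ := by positivity
  obtain ⟨r, hr, hxr⟩ := hD τ hτp
  have hlim := tendsto_one_div_add_atTop_nhds_zero_nat (𝕜 := ℝ)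
  have hev : ∀ᶠ j : ℕ in atTop, ‖D - (θ j * a) • e‖ < a / 4 := by
    filter_upwards [hx2, hlim.eventually (gt_mem_nhds hr), hlim.eventually (gt_mem_nhds hτp)]
      with j hj1 hj2 hj3
    set l := D - (θ j * a) • e with hl
    by_cases hl0 : l = 0
    · rw [hl0, norm_zero]; positivity
    have hlp : 0 < ‖l‖ := norm_pos_iff.2 hl0
    have hxG : x ∈ Spread φ c (s j) (t j) := by
      by_contra hcon
      exact hj1 ⟨hxV, hcon⟩
    obtain ⟨y, hy1, hy2, hy3⟩ := hxG (‖l‖⁻¹ • l) (by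
      rw [mem_sphere_zero_iff_norm, norm_smul, norm_inv, norm_norm, inv_mul_cancel₀ hlp.ne'])
    rw [real_inner_smul_left, abs_mul, abs_of_pos (inv_pos.2 hlp), inv_mul_eq_div,
      lt_div_iff₀ hlp] at hy3
    have hd : 0 < dist x y := (hs j).trans hy1
    have e1 := hxr y hd (lt_of_le_of_lt (hy2.le.trans (htj j)) hj2)
    have e2 := hfh j x y hy1.le hy2.le
    have e3 := (hTj j).1 x y hy1.le hy2.le
    have e4 : 1 / ((j : ℝ) + 1) * dist x y ≤ τ * dist x y := by gcongr
    have e5 : inner ℝ l (φ x - φ y) = inner ℝ D (φ x - φ y) - θ j * (g x - g y) := by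
      simp only [hl, g, inner_sub_left, real_inner_smul_left, inner_sub_right]
      ring
    have e6 : inner ℝ l (φ x - φ y) = -(f x - f y - inner ℝ D (φ x - φ y)) +
        (((f x - f y) - (h j x - h j y)) + ((h j x - h j y) - θ j * (g x - g y))) := by
      rw [e5]; ring
    have e7 : |inner ℝ l (φ x - φ y)| ≤ 3 * τ * dist x y := by
      rw [e6]
      refine (abs_add_le _ _).trans ?_
      rw [abs_neg]
      have := abs_add_le ((f x - f y) - (h j x - h j y)) ((h j x - h j y) - θ j * (g x - g y))
      linarith
    have e8 : (c * ‖l‖) * dist x y < (3 * τ) * dist x y := by linarith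
    have e9 : c * ‖l‖ < 3 * τ := lt_of_mul_lt_mul_right e8 hd.le
    have e10 : c * ‖l‖ < c * (a / 4) := by
      have : 0 < c * a := by positivity
      rw [hτ] at e9; linarith
    exact lt_of_mul_lt_mul_left e10 hcp.le
  obtain ⟨J, hJ⟩ := eventually_atTop.1 hev
  have h1 := hJ (2 * J) (by omega)
  have h2 := hJ (2 * J + 1) (by omega)
  have t1 : θ (2 * J) = 0 := by simp [θ]
  have t2 : θ (2 * J + 1) = 1 / 2 := by
    have : ¬ Even (2 * J + 1) := by simp
    simp only [θ, if_neg this]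
  rw [t1] at h1
  rw [t2] at h2
  have h3 : (1 / 2 * a) • e = (D - (0 * a) • e) - (D - (1 / 2 * a) • e) := by
    rw [zero_mul, zero_smul]; abel
  have h4 : ‖(1 / 2 * a) • e‖ = 1 / 2 * a := by
    rw [norm_smul, he, mul_one, Real.norm_of_nonneg (by positivity)]
  have h5 := norm_sub_le (D - (0 * a) • e) (D - (1 / 2 * a) • e)
  rw [← h3, h4] at h5
  linarith

lemma not_lds {X : Type*} [MetricSpace X] [TopologicalSpace.SeparableSpace X]
    [MeasurableSpace X] [BorelSpace X] (μ : Measure X) [IsFiniteMeasure μ]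
    (hflat : FlatApprox X) (hiso : μ {x : X | 𝓝[≠] x = ⊥} = 0) (h : IsLDS X μ) :
    μ univ = 0 := by
  obtain ⟨n, U, φ, hUm, hUu, hφ, hdiff⟩ := h
  rw [← hUu]
  refine measure_iUnion_null fun i => ?_
  have hL : ∀ f : X → ℝ, (∀ x y, |f x - f y| ≤ dist x y) → ∃ K : ℝ≥0, LipschitzWith K f := by
    intro f hf
    exact ⟨1, LipschitzWith.of_dist_le_mul fun x y => by simpa [Real.dist_eq] using hf x y⟩
  rcases Nat.eq_zero_or_pos (n i) with h0 | hpos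
  · refine case_zero μ hflat hiso (U i) (hUm i) fun f hf => ?_
    filter_upwards [hdiff f (hL f hf) i] with x hx
    obtain ⟨D, hD, -⟩ := hx
    rw [diffAt_iff] at hD
    have : IsEmpty (Fin (n i)) := by rw [h0]; infer_instance
    have hD0 : D = 0 := Subsingleton.elim _ _
    simpa [hD0] using hD
  · obtain ⟨K, hK⟩ := hφ i
    refine case_pos μ hflat ⟨0, hpos⟩ (φ i) (K + 1) (by positivity) (fun x y => ?_) (U i) (hUm i)
      fun f hf => hdiff f (hL f hf) i
    rw [← dist_eq_norm]
    refine (hK.dist_le_mul x y).trans ?_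
    gcongr
    linarith

lemma snowflake_topology (X : Type*) [m : MetricSpace X] (δ : ℝ) (h0 : 0 < δ) (h1 : δ ≤ 1) :
    (snowflakeMetric X δ h0 h1).toUniformSpace.toTopologicalSpace =
      m.toUniformSpace.toTopologicalSpace := by
  refine TopologicalSpace.ext_nhds fun x => ?_
  refine (@Metric.nhds_basis_ball X (snowflakeMetric X δ h0 h1).toPseudoMetricSpace x).ext
    (Metric.nhds_basis_ball (x := x)) ?_ ?_
  · intro r hr
    refine ⟨r ^ (1 / δ), Real.rpow_pos_of_pos hr _, fun y hy => ?_⟩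
    rw [Metric.mem_ball] at hy
    change dist y x ^ δ < r
    have := Real.rpow_lt_rpow dist_nonneg hy h0
    rwa [← Real.rpow_mul hr.le, one_div, inv_mul_cancel₀ h0.ne', Real.rpow_one] at this
  · intro r hr
    refine ⟨r ^ δ, Real.rpow_pos_of_pos hr _, fun y hy => ?_⟩
    change dist y x ^ δ < r ^ δ at hy
    rw [Metric.mem_ball]
    exact (Real.rpow_lt_rpow_iff dist_nonneg hr.le h0).1 hy

/-- **Snowflaked spaces are not Lipschitz differentiability spaces.**  Let `(X,d,μ)` be a
metric measure space and `0 < δ < 1`.  Then `(X, d^δ, μ)` is a Lipschitz differentiability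
space if and only if `μ(X) = 0`. -/
theorem snowflake_lds_iff
    {X : Type*} [MetricSpace X] [CompleteSpace X] [TopologicalSpace.SeparableSpace X]
    [MeasurableSpace X] [BorelSpace X] (μ : Measure X) [IsFiniteMeasure μ]
    (hiso : μ {x : X | 𝓝[≠] x = ⊥} = 0)
    (δ : ℝ) (h0 : 0 < δ) (h1 : δ < 1) :
    @IsLDS X (snowflakeMetric X δ h0 h1.le) _ μ ↔ μ Set.univ = 0 := by
  constructor
  · intro h
    have htop := snowflake_topology X δ h0 h1.le
    refine @not_lds X (snowflakeMetric X δ h0 h1.le) ?_ _ ?_ μ _ ?_ ?_ h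
    · rw [htop]; infer_instance
    · rw [htop]; infer_instance
    · intro f hf ε hε
      exact flat_aux δ h0 h1 f hf ε hε
    · rw [htop]; exact hiso
  · intro h
    have hμ : μ = 0 := Measure.measure_univ_eq_zero.1 h
    letI := snowflakeMetric X δ h0 h1.le
    refine ⟨fun _ => 0, fun _ => univ, fun _ _ => 0, fun _ => MeasurableSet.univ, iUnion_const _,
      fun _ => ⟨0, LipschitzWith.const 0⟩, fun f _ i => ?_⟩
    rw [hμ, Measure.restrict_zero]
    exact ae_zero.symm ▸ Filter.eventually_bot
end

section
/- Let (U,φ) be a structured chart in a metric measure space (X,d,μ), let S ⊂ U be Borel and L, β > 0. Suppose there exists a sequence of L-Lipschitz functions f_m: X → ℝ such that: (1) for every x₀ ∈ S there exists M ∈ ℕ such that for each m ≥ M there exists x ∈ X with 0 < d(x,x₀) < 1/m and |f_m(x)−f_m(x₀)| ≥ β d(x,x₀); and (2) for every m ∈ ℕ there exists ρ_m > 0 such that for every x₀ ∈ S and all y, z ∈ B(x₀,ρ_m), |f_m(y)−f_m(z)| ≤ d(y,z)/m. Then there exists a Lipschitz function F: X → ℝ that is differentiable with respect to (U,φ) at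 μ-almost no point of S. In particular, if (X,d,μ) is a Lipschitz differentiability space then μ(S) = 0. -/
open MeasureTheory Metric Filter Set Topology
open scoped ENNReal NNReal

noncomputable section

/-- `(U,φ)` is a `λ`-structured chart of dimension `n`: `U` is compact and there is a subset
`U' ⊆ U` of full measure such that for every `R > 0` there is an `r > 0` so that for every
`x₀ ∈ U'` there are points `x₁,…,xₙ ∈ U` with `r < d(xᵢ,x₀) < R` and
`max_i |(φ(xᵢ)-φ(x₀))·v| / d(xᵢ,x₀) ≥ λ` for every unit vector `v`. -/
def IsStructuredChartWith {X : Type*} [MetricSpace X] [MeasurableSpace X] (μ : Measure X)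
    {n : ℕ} (U : Set X) (φ : X → EuclideanSpace ℝ (Fin n)) (lam : ℝ) : Prop :=
  IsCompact U ∧ ∃ U' : Set X, U' ⊆ U ∧ μ (U \ U') = 0 ∧
    ∀ R : ℝ, 0 < R → ∃ r : ℝ, 0 < r ∧ ∀ x₀ ∈ U', ∃ x : Fin n → X,
      (∀ i, x i ∈ U ∧ r < dist (x i) x₀ ∧ dist (x i) x₀ < R) ∧
      ∀ v : EuclideanSpace ℝ (Fin n), ‖v‖ = 1 →
        lam ≤ ⨆ i : Fin n, |euclDot (φ (x i) - φ x₀) v| / dist (x i) x₀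

end

lemma euclDot_eq_inner {n : ℕ} (a b : EuclideanSpace ℝ (Fin n)) :
    euclDot a b = inner ℝ b a := by
  simp [euclDot, PiLp.inner_apply]

lemma abs_euclDot_le {n : ℕ} (a b : EuclideanSpace ℝ (Fin n)) :
    |euclDot a b| ≤ ‖a‖ * ‖b‖ := by
  rw [euclDot_eq_inner, mul_comm]
  exact abs_real_inner_le_norm b a

lemma euclDot_sub_left' {n : ℕ} (a b c : EuclideanSpace ℝ (Fin n)) :
    euclDot (a - b) c = euclDot a c - euclDot b c := by
  simp [euclDot_eq_inner, inner_sub_right]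

lemma euclDot_smul_left' {n : ℕ} (t : ℝ) (a c : EuclideanSpace ℝ (Fin n)) :
    euclDot (t • a) c = t * euclDot a c := by
  simp [euclDot_eq_inner, inner_smul_right]

/-- At scale between `r` and `R`, every direction is seen by the chart at `x`. -/
def GoodAt {X : Type*} [MetricSpace X] {n : ℕ} (φ : X → EuclideanSpace ℝ (Fin n))
    (lam R r : ℝ) (x : X) : Prop :=
  ∀ v : EuclideanSpace ℝ (Fin n), ‖v‖ = 1 → ∃ y, r < dist y x ∧ dist y x < R ∧
    lam * dist y x ≤ |euclDot v (φ y - φ x)|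

/-- Diagonal subsequence which is uniformly Cauchy on a compact set. -/
lemma exists_cauchy_subseq {X : Type*} [MetricSpace X] [TopologicalSpace.SeparableSpace X]
    (U : Set X) (hU : IsCompact U) (p : X) (L : ℝ) (hL : 0 < L) (f : ℕ → X → ℝ)
    (hf : ∀ m y z, |f m y - f m z| ≤ L * dist y z) :
    ∃ ψ : ℕ → ℕ, StrictMono ψ ∧ ∀ ε > 0, ∃ N, ∀ m ≥ N, ∀ m' ≥ N, ∀ x ∈ U,
      |(f (ψ m) x - f (ψ m) p) - (f (ψ m') x - f (ψ m') p)| ≤ ε := by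
  have : Nonempty X := ⟨p⟩
  let u := TopologicalSpace.denseSeq X
  have hu : DenseRange u := TopologicalSpace.denseRange_denseSeq X
  have hK : IsCompact (Set.univ.pi fun i : ℕ => Icc (-(L * dist (u i) p)) (L * dist (u i) p)) :=
    isCompact_univ_pi fun i => isCompact_Icc
  obtain ⟨a, -, ψ, hψ, hlim⟩ := hK.tendsto_subseq (x := fun m i => f m (u i) - f m p) (by
    intro m i _
    exact abs_le.mp (hf m (u i) p))
  refine ⟨ψ, hψ, fun ε hε => ?_⟩
  have hδ : 0 < ε / (4 * L) := by positivity
  obtain ⟨t, ht⟩ := hU.elim_finite_subcover (fun i => ball (u i) (ε / (4 * L)))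
    (fun i => isOpen_ball) (by
      intro x _
      obtain ⟨i, hi⟩ := hu.exists_dist_lt x hδ
      exact mem_iUnion.mpr ⟨i, by simpa using hi⟩)
  have hev : ∀ᶠ m in atTop, ∀ i ∈ t, |(f (ψ m) (u i) - f (ψ m) p) - a i| < ε / 4 := by
    rw [Filter.eventually_all_finset]
    intro i _
    have := (tendsto_pi_nhds.mp hlim) i
    have := Metric.tendsto_nhds.mp this (ε / 4) (by positivity)
    filter_upwards [this] with m hm
    exact hm
  obtain ⟨N, hN⟩ := eventually_atTop.mp hev
  refine ⟨N, fun m hm m' hm' x hx => ?_⟩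
  obtain ⟨i, hi, hxi⟩ : ∃ i ∈ t, x ∈ ball (u i) (ε / (4 * L)) := by simpa using ht hx
  have e1 := hN m hm i hi
  have e2 := hN m' hm' i hi
  have hb : L * dist x (u i) ≤ ε / 4 := by
    have := mul_le_mul_of_nonneg_left (mem_ball.mp hxi).le hL.le
    calc _ ≤ _ := this
      _ = ε / 4 := by field_simp
  have e3 := (hf (ψ m) x (u i)).trans hb
  have e4 := (hf (ψ m') x (u i)).trans hb
  rw [abs_le] at *
  rw [abs_lt] at *
  constructor <;> linarith [e1.1, e1.2, e2.1, e2.2, e3.1, e3.2, e4.1, e4.2]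

/-- The building block. -/
lemma exists_bump {X : Type*} [MetricSpace X] (S : Set X) (hne : S.Nonempty)
    (L β : ℝ) (hL : 0 < L) (hβ : 0 < β) (h : ℕ → X → ℝ)
    (hlip : ∀ m y z, |h m y - h m z| ≤ L * dist y z)
    (hC : ∀ ε > 0, ∃ N, ∀ m ≥ N, ∀ m' ≥ N, ∀ x ∈ S, |h m x - h m' x| ≤ ε)
    (M : X → ℕ)
    (h1 : ∀ x₀ ∈ S, ∀ m : ℕ, M x₀ ≤ m → ∃ x : X,
      0 < dist x x₀ ∧ dist x x₀ < 1 / (m : ℝ) ∧ β * dist x x₀ ≤ |h m x - h m x₀|)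
    (h2 : ∀ m : ℕ, 0 < m → ∃ ρ : ℝ, 0 < ρ ∧ ∀ x₀ ∈ S, ∀ y ∈ ball x₀ ρ, ∀ z ∈ ball x₀ ρ,
      |h m y - h m z| ≤ dist y z / (m : ℝ))
    (ε η : ℝ) (hε : 0 < ε) (hη : 0 < η) (N : ℕ) :
    ∃ (g : X → ℝ) (ρ : ℝ), 0 < ρ ∧ (∀ y z, |g y - g z| ≤ (2 * L + 1) * dist y z) ∧
      (∀ y, |g y| ≤ ε) ∧ (∀ y, ε ≤ infDist y S → g y = 0) ∧
      (∀ x₀ ∈ S, ∀ y ∈ ball x₀ ρ, ∀ z ∈ ball x₀ ρ, |g y - g z| ≤ η * dist y z) ∧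
      (∀ x₀ ∈ S, M x₀ ≤ N → ∃ x, 0 < dist x x₀ ∧ dist x x₀ < ε ∧
        β / 2 * dist x x₀ ≤ |g x - g x₀|) := by
  obtain ⟨N0, hN0⟩ := hC (ε / 2) (by positivity)
  set δ : ℝ := ε / (2 * (2 * L + 1)) with hδ
  have hδ0 : 0 < δ := by positivity
  have hδε : δ * (2 * L + 1) = ε / 2 := by rw [hδ]; field_simp
  have key : ∀ c : ℝ, 0 < c → ∃ n : ℕ, ∀ m ≥ n, 1 / (m : ℝ) ≤ c := by
    intro c hc
    obtain ⟨n, hn⟩ := exists_nat_gt (1 / c)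
    refine ⟨n, fun m hm => ?_⟩
    have : (n : ℝ) ≤ m := by exact_mod_cast hm
    have hpos : 0 < (n : ℝ) := lt_trans (by positivity) hn
    rw [div_le_iff₀ (by linarith)]
    rw [div_lt_iff₀ hc] at hn
    nlinarith
  obtain ⟨n1, hn1⟩ := key (min (η / 2) (β / 2)) (by positivity)
  set m := max 1 (max N0 n1) with hm
  have hmpos : 0 < m := by omega
  obtain ⟨ρ1, hρ1, hfl1⟩ := h2 m hmpos
  obtain ⟨n2, hn2⟩ := key (min (min ρ1 δ) (min ε (η / 2))) (by positivity)
  set m' := max (max 1 N) (max N0 n2) with hm'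
  obtain ⟨ρ2, hρ2, hfl2⟩ := h2 m' (by omega)
  have em := hn1 m (by omega)
  have em' := hn2 m' (by omega)
  simp only [le_min_iff] at em em'
  obtain ⟨em1, em2⟩ := em
  obtain ⟨⟨em1', em2'⟩, em3', em4'⟩ := em'
  let g0 : X → ℝ := fun y => h m y - h m' y
  let w : X → ℝ := fun y => max 0 (ε - infDist y S)
  let g : X → ℝ := fun y => max (-w y) (min (w y) (g0 y))
  have hg0lip : ∀ y z, |g0 y - g0 z| ≤ 2 * L * dist y z := by
    intro y z
    have a1 := abs_le.mp (hlip m y z)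
    have a2 := abs_le.mp (hlip m' y z)
    simp only [g0]
    rw [abs_le]; constructor <;> linarith [a1.1, a1.2, a2.1, a2.2]
  have hg0S : ∀ x ∈ S, |g0 x| ≤ ε / 2 := fun x hx => hN0 m (by omega) m' (by omega) x hx
  have hw0 : ∀ y, 0 ≤ w y := fun y => le_max_left _ _
  have hwlip : ∀ y z, |w y - w z| ≤ dist y z := by
    intro y z
    have b1 : infDist y S ≤ infDist z S + dist y z := infDist_le_infDist_add_dist
    have b2 : infDist z S ≤ infDist y S + dist z y := infDist_le_infDist_add_dist
    rw [dist_comm z y] at b2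
    calc |w y - w z| ≤ max |(0:ℝ) - 0| |(ε - infDist y S) - (ε - infDist z S)| :=
          abs_max_sub_max_le_max _ _ _ _
      _ ≤ _ := by
        rw [max_le_iff, abs_le, abs_le]
        refine ⟨⟨?_, ?_⟩, ?_, ?_⟩ <;> linarith [dist_nonneg (x := y) (y := z)]
  have hagree : ∀ y, infDist y S < δ → g y = g0 y := by
    intro y hy
    have hb : |g0 y| ≤ w y := by
      obtain ⟨x, hx, hxy⟩ := (infDist_lt_iff hne).mp hy
      have c1 := abs_le.mp (hg0lip y x)
      have c2 := abs_le.mp (hg0S x hx)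
      have c3 : 2 * L * dist y x ≤ 2 * L * δ := by gcongr
      have c4 : ε - infDist y S ≤ w y := le_max_right _ _
      rw [abs_le]
      constructor <;> linarith [c1.1, c1.2, c2.1, c2.2]
    have hb' := abs_le.mp hb
    simp only [g]
    rw [min_eq_right hb'.2, max_eq_right hb'.1]
  have hball : ∀ x₀ ∈ S, ∀ y ∈ ball x₀ δ, g y = g0 y := by
    intro x₀ hx₀ y hy
    exact hagree y (lt_of_le_of_lt (infDist_le_dist_of_mem hx₀) (mem_ball.mp hy))
  have hgw : ∀ y, |g y| ≤ w y := by
    intro y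
    rw [abs_le]
    exact ⟨le_max_left _ _, max_le (by linarith [hw0 y]) (min_le_left _ _)⟩
  refine ⟨g, min δ (min ρ1 ρ2), by positivity, ?_, ?_, ?_, ?_, ?_⟩
  · intro y z
    have hd := dist_nonneg (x := y) (y := z)
    have hLd : 0 ≤ L * dist y z := by positivity
    have d1 := hwlip y z
    have d2 := hg0lip y z
    calc |g y - g z| ≤ max |-w y - -w z| |min (w y) (g0 y) - min (w z) (g0 z)| :=
          abs_max_sub_max_le_max _ _ _ _
      _ ≤ max |-w y - -w z| (max |w y - w z| |g0 y - g0 z|) :=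
          max_le_max le_rfl (abs_min_sub_min_le_max _ _ _ _)
      _ ≤ _ := by
        have : |-w y - -w z| = |w y - w z| := by rw [← abs_neg]; congr 1; ring
        rw [this]
        refine max_le ?_ (max_le ?_ ?_) <;> nlinarith
  · intro y
    refine (hgw y).trans (max_le hε.le ?_)
    linarith [infDist_nonneg (x := y) (s := S)]
  · intro y hy
    have : w y = 0 := max_eq_left (by linarith)
    have := this ▸ hgw y
    exact abs_nonpos_iff.mp this
  · intro x₀ hx₀ y hy z hz
    simp only [mem_ball, lt_min_iff] at hy hz
    rw [hball x₀ hx₀ y hy.1, hball x₀ hx₀ z hz.1]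
    have f1 := abs_le.mp (hfl1 x₀ hx₀ y hy.2.1 z hz.2.1)
    have f2 := abs_le.mp (hfl2 x₀ hx₀ y hy.2.2 z hz.2.2)
    have hd := dist_nonneg (x := y) (y := z)
    have q1 : dist y z / (m : ℝ) ≤ η / 2 * dist y z := by
      rw [div_eq_mul_one_div, mul_comm]; gcongr
    have q2 : dist y z / (m' : ℝ) ≤ η / 2 * dist y z := by
      rw [div_eq_mul_one_div, mul_comm]; gcongr
    simp only [g0]
    rw [abs_le]
    constructor <;> linarith [f1.1, f1.2, f2.1, f2.2]
  · intro x₀ hx₀ hM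
    obtain ⟨x, hx0, hx1, hx2⟩ := h1 x₀ hx₀ m' (by omega)
    refine ⟨x, hx0, by linarith, ?_⟩
    rw [hball x₀ hx₀ x (mem_ball.mpr (by linarith)), hball x₀ hx₀ x₀ (mem_ball_self hδ0)]
    have f1 := hfl1 x₀ hx₀ x (mem_ball.mpr (by linarith)) x₀ (mem_ball_self hρ1)
    have q1 : dist x x₀ / (m : ℝ) ≤ β / 2 * dist x x₀ := by
      rw [div_eq_mul_one_div, mul_comm]; gcongr
    have t : |h m' x - h m' x₀| ≤ |g0 x - g0 x₀| + |h m x - h m x₀| := by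
      have : h m' x - h m' x₀ = -(g0 x - g0 x₀) + (h m x - h m x₀) := by simp only [g0]; ring
      rw [this]
      exact (abs_add_le _ _).trans (by rw [abs_neg])
    linarith

/-- Core construction. -/
lemma core_construction {X : Type*} [MetricSpace X] (S : Set X)
    (L β : ℝ) (hL : 0 < L) (hβ : 0 < β) (h : ℕ → X → ℝ)
    (hlip : ∀ m y z, |h m y - h m z| ≤ L * dist y z)
    (hC : ∀ ε > 0, ∃ N, ∀ m ≥ N, ∀ m' ≥ N, ∀ x ∈ S, |h m x - h m' x| ≤ ε)
    (M : X → ℕ)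
    (h1 : ∀ x₀ ∈ S, ∀ m : ℕ, M x₀ ≤ m → ∃ x : X,
      0 < dist x x₀ ∧ dist x x₀ < 1 / (m : ℝ) ∧ β * dist x x₀ ≤ |h m x - h m x₀|)
    (h2 : ∀ m : ℕ, 0 < m → ∃ ρ : ℝ, 0 < ρ ∧ ∀ x₀ ∈ S, ∀ y ∈ ball x₀ ρ, ∀ z ∈ ball x₀ ρ,
      |h m y - h m z| ≤ dist y z / (m : ℝ))
    {n : ℕ} (φ : X → EuclideanSpace ℝ (Fin n)) (K : ℝ) (hK : 0 ≤ K)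
    (hφ : ∀ y z, ‖φ y - φ z‖ ≤ K * dist y z) (lam : ℝ) (hlam : 0 < lam)
    (hgood : ∀ R : ℝ, 0 < R → ∃ r : ℝ, 0 < r ∧ ∀ x ∈ S, GoodAt φ lam R r x) :
    ∃ F : X → ℝ, (∃ C : ℝ≥0, LipschitzWith C F) ∧ ∀ x ∈ S, ∀ D, ¬ DiffAt F φ x D := by
  rcases S.eq_empty_or_nonempty with rfl | hne
  · exact ⟨fun _ => 0, ⟨0, LipschitzWith.const 0⟩, by simp⟩
  set η : ℝ := β / (12 * (1 + K / lam)) with hηdef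
  have hKl : 0 ≤ K / lam := by positivity
  have hη : 0 < η := by positivity
  have hηβ : 3 * η * (1 + K / lam) = β / 4 := by rw [hηdef]; field_simp; norm_num
  have hη3 : 3 * η ≤ β / 4 := by nlinarith [mul_nonneg hη.le hKl]
  set θ : ℝ := min (1 / 4) (η / 4) with hθ
  have hθ0 : 0 < θ := by positivity
  have hθ1 : θ ≤ 1 / 4 := min_le_left _ _
  have hθ2 : θ ≤ η / 4 := min_le_right _ _
  have step : ∀ (k : ℕ) (e : {e : ℝ // 0 < e}), ∃ (g : X → ℝ) (ρ r : ℝ) (e' : {e : ℝ // 0 < e}),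
      0 < r ∧ r ≤ ρ ∧ ρ ≤ e.1 ∧ e'.1 ≤ θ * r ∧
      (∀ y z, |g y - g z| ≤ (2 * L + 1) * dist y z) ∧
      (∀ y, |g y| ≤ e.1) ∧ (∀ y, e.1 ≤ infDist y S → g y = 0) ∧
      (∀ x₀ ∈ S, ∀ y ∈ ball x₀ ρ, ∀ z ∈ ball x₀ ρ,
        |g y - g z| ≤ η * (1 / 2) ^ (k + 1) * dist y z) ∧
      (∀ x₀ ∈ S, M x₀ ≤ k → ∃ x, 0 < dist x x₀ ∧ dist x x₀ < e.1 ∧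
        β / 2 * dist x x₀ ≤ |g x - g x₀|) ∧
      (∀ x ∈ S, GoodAt φ lam ρ r x) := by
    rintro k ⟨e, he⟩
    obtain ⟨g, ρ, hρ, p1, p2, p3, p4, p5⟩ := exists_bump S hne L β hL hβ h hlip hC M h1 h2 e
      (η * (1 / 2) ^ (k + 1)) he (by positivity) k
    have hρ' : 0 < min ρ e := by positivity
    obtain ⟨r, hr, hr'⟩ := hgood _ hρ'
    have hr0 : 0 < min r (min ρ e) := by positivity
    refine ⟨g, min ρ e, min r (min ρ e), ⟨θ * min r (min ρ e), by positivity⟩, hr0,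
      min_le_right _ _, min_le_right _ _, le_rfl, p1, p2, p3, ?_, p5, ?_⟩
    · intro x₀ hx₀ y hy z hz
      exact p4 x₀ hx₀ y (ball_subset_ball (min_le_left _ _) hy) z
        (ball_subset_ball (min_le_left _ _) hz)
    · intro x hx v hv
      obtain ⟨y, q1, q2⟩ := hr' x hx v hv
      exact ⟨y, lt_of_le_of_lt (min_le_left _ _) q1, q2⟩
  choose G P Rr E' hstep using step
  let e : ℕ → {e : ℝ // 0 < e} := fun k => Nat.rec ⟨1, one_pos⟩ (fun k e => E' k e) k
  let g : ℕ → X → ℝ := fun k => G k (e k)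
  let ε : ℕ → ℝ := fun k => (e k).1
  let ρ : ℕ → ℝ := fun k => P k (e k)
  let r : ℕ → ℝ := fun k => Rr k (e k)
  have hε0 : ∀ k, 0 < ε k := fun k => (e k).2
  have hr0 : ∀ k, 0 < r k := fun k => (hstep k (e k)).1
  have hrρ : ∀ k, r k ≤ ρ k := fun k => (hstep k (e k)).2.1
  have hρε : ∀ k, ρ k ≤ ε k := fun k => (hstep k (e k)).2.2.1
  have hεr : ∀ k, ε (k + 1) ≤ θ * r k := fun k => (hstep k (e k)).2.2.2.1
  have glip : ∀ k y z, |g k y - g k z| ≤ (2 * L + 1) * dist y z :=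
    fun k => (hstep k (e k)).2.2.2.2.1
  have gsup : ∀ k y, |g k y| ≤ ε k := fun k => (hstep k (e k)).2.2.2.2.2.1
  have gsupp : ∀ k y, ε k ≤ infDist y S → g k y = 0 := fun k => (hstep k (e k)).2.2.2.2.2.2.1
  have gflat : ∀ k, ∀ x₀ ∈ S, ∀ y ∈ ball x₀ (ρ k), ∀ z ∈ ball x₀ (ρ k),
      |g k y - g k z| ≤ η * (1 / 2) ^ (k + 1) * dist y z :=
    fun k => (hstep k (e k)).2.2.2.2.2.2.2.1
  have gwit : ∀ k, ∀ x₀ ∈ S, M x₀ ≤ k → ∃ x, 0 < dist x x₀ ∧ dist x x₀ < ε k ∧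
        β / 2 * dist x x₀ ≤ |g k x - g k x₀| := fun k => (hstep k (e k)).2.2.2.2.2.2.2.2.1
  have ggood : ∀ k, ∀ x ∈ S, GoodAt φ lam (ρ k) (r k) x :=
    fun k => (hstep k (e k)).2.2.2.2.2.2.2.2.2
  have hεone : ε 0 = 1 := rfl
  clear_value ε ρ r g
  clear hstep
  have hρ0 : ∀ k, 0 < ρ k := fun k => (hr0 k).trans_le (hrρ k)
  have hεhalf : ∀ k, ε (k + 1) ≤ ε k / 4 := by
    intro k
    have := hεr k
    have a := hrρ k
    have b := hρε k
    nlinarith [hr0 k]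
  have hεgeom : ∀ k j, ε (j + k) ≤ ε k * (1 / 2) ^ j := by
    intro k j
    induction j with
    | zero => simp
    | succ j ih =>
      have := hεhalf (j + k)
      rw [show j + 1 + k = j + k + 1 by ring, pow_succ]
      linarith [hε0 (j + k)]
  have hεanti : Antitone ε := antitone_nat_of_succ_le fun k => by linarith [hεhalf k, hε0 k]
  have hρanti : Antitone ρ := antitone_nat_of_succ_le fun k => by
    have := hεr k
    have a := hrρ k
    have b := hρε (k + 1)
    nlinarith [hr0 k]
  have hε4ρ : ∀ k, ε (k + 1) ≤ ρ k / 4 := by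
    intro k
    have := hεr k
    have a := hrρ k
    nlinarith [hr0 k]
  have hε4r : ∀ k, 4 * ε (k + 1) ≤ η * r k := by
    intro k
    have := hεr k
    nlinarith [hr0 k]
  have hεlim : Tendsto ε atTop (𝓝 0) := by
    refine squeeze_zero (fun k => (hε0 k).le) (fun k => ?_)
      (tendsto_pow_atTop_nhds_zero_of_lt_one (r := (1 / 2 : ℝ)) (by norm_num) (by norm_num))
    have := hεgeom 0 k
    simpa [hεone] using this
  -- tails
  let T : ℕ → X → ℝ := fun k y => ∑' j, g (j + k) y
  have hsgeo : ∀ k, HasSum (fun j : ℕ => ε k * (1 / 2 : ℝ) ^ j) (ε k * 2) :=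
    fun k => hasSum_geometric_two.mul_left (ε k)
  have hTsum : ∀ k y, Summable fun j => g (j + k) y := by
    intro k y
    refine Summable.of_norm_bounded (hsgeo k).summable (fun j => ?_)
    exact (gsup (j + k) y).trans (hεgeom k j)
  have hTle : ∀ k y, |T k y| ≤ 2 * ε k := by
    intro k y
    have := tsum_of_norm_bounded (hsgeo k) (f := fun j => g (j + k) y)
      (fun j => (gsup (j + k) y).trans (hεgeom k j))
    rw [Real.norm_eq_abs] at this
    simp only [T]; linarith
  have hTsupp : ∀ k y, ε k ≤ infDist y S → T k y = 0 := by
    intro k y hy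
    have : ∀ j, g (j + k) y = 0 := fun j =>
      gsupp _ y ((hεanti (Nat.le_add_left k j)).trans hy)
    simp [T, this]
  let Q : ℕ → X → ℝ := fun k y => ∑ j ∈ Finset.range k, g j y
  let F : X → ℝ := T 0
  have hF : ∀ k y, F y = Q k y + T k y := by
    intro k y
    have := (hTsum 0 y).sum_add_tsum_nat_add k
    simpa [F, T, Q] using this.symm
  have hQs : ∀ k y, Q (k + 1) y = Q k y + g k y := fun k y => Finset.sum_range_succ _ _
  have hQflat : ∀ k, ∀ x₀ ∈ S, ∀ y z, (∀ j < k, y ∈ ball x₀ (ρ j)) →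
      (∀ j < k, z ∈ ball x₀ (ρ j)) → |Q k y - Q k z| ≤ η * dist y z := by
    intro k x₀ hx₀ y z hy hz
    have hd := dist_nonneg (x := y) (y := z)
    have main : ∀ i ≤ k, |Q i y - Q i z| ≤ η * (1 - (1 / 2) ^ i) * dist y z := by
      intro i
      induction i with
      | zero => intro _; simp [Q]
      | succ i ih =>
        intro hi
        have a := ih (by omega)
        have b := gflat i x₀ hx₀ y (hy i (by omega)) z (hz i (by omega))
        rw [hQs, hQs]
        calc _ = |(Q i y - Q i z) + (g i y - g i z)| := by congr 1; ring
          _ ≤ _ := abs_add_le _ _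
          _ ≤ _ := add_le_add a b
          _ = _ := by rw [pow_succ]; ring
    refine (main k le_rfl).trans ?_
    have : 0 < (1 / 2 : ℝ) ^ k := by positivity
    have : 0 ≤ η * dist y z * (1 / 2 : ℝ) ^ k := by positivity
    nlinarith
  have hFlip : ∀ y z, |F y - F z| ≤ (η + (2 * L + 1) + 4) * dist y z := by
    intro y z
    rcases eq_or_ne y z with rfl | hyz
    · simp
    have hd : 0 < dist y z := dist_pos.mpr hyz
    have hi0 := infDist_nonneg (x := y) (s := S)
    set s := infDist y S + dist y z with hs
    have hs0 : 0 < s := by positivity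
    have hex : ∃ k, ρ k ≤ s := by
      obtain ⟨k, hk⟩ := (hεlim.eventually (gt_mem_nhds hs0)).exists
      exact ⟨k, (hρε k).trans hk.le⟩
    classical
    obtain ⟨k, hk, hk'⟩ : ∃ k, ρ k ≤ s ∧ ∀ j < k, s < ρ j :=
      ⟨Nat.find hex, Nat.find_spec hex, fun j hj => not_le.mp (Nat.find_min hex hj)⟩
    have a1 : |Q k y - Q k z| ≤ η * dist y z := by
      rcases Nat.eq_zero_or_pos k with rfl | hkpos
      · simp only [Q, Finset.range_zero, Finset.sum_empty, sub_self, abs_zero]; positivity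
      have hlt : infDist y S < ρ (k - 1) - dist y z := by
        have := hk' (k - 1) (by omega)
        linarith
      obtain ⟨x₀, hx₀, hyx⟩ := (infDist_lt_iff hne).mp hlt
      have hanti : ∀ j < k, ρ (k - 1) ≤ ρ j := fun j hj => hρanti (by omega)
      refine hQflat k x₀ hx₀ y z (fun j hj => ?_) (fun j hj => ?_)
      · rw [mem_ball]; linarith [hanti j hj]
      · rw [mem_ball]
        have := dist_triangle z y x₀
        rw [dist_comm z y] at this
        linarith [hanti j hj]
    have a2 := glip k y z
    have a3 : |T (k + 1) y - T (k + 1) z| ≤ 4 * dist y z := by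
      have hk4 := hε4ρ k
      rcases lt_or_ge (dist y z) (s / 4) with hlt | hge
      · have b1 : infDist y S ≤ infDist z S + dist y z := infDist_le_infDist_add_dist
        rw [hTsupp (k + 1) y (by linarith), hTsupp (k + 1) z (by linarith)]
        simp only [sub_self, abs_zero]; positivity
      · have c1 := abs_le.mp (hTle (k + 1) y)
        have c2 := abs_le.mp (hTle (k + 1) z)
        rw [abs_le]
        constructor <;> linarith [c1.1, c1.2, c2.1, c2.2]
    rw [hF (k + 1) y, hF (k + 1) z, hQs, hQs]
    calc _ = |(Q k y - Q k z) + (g k y - g k z) + (T (k + 1) y - T (k + 1) z)| := by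
          congr 1; ring
      _ ≤ _ := abs_add_three _ _ _
      _ ≤ _ := by linarith
  refine ⟨F, ⟨Real.toNNReal (η + (2 * L + 1) + 4), LipschitzWith.of_dist_le_mul fun y z => ?_⟩, ?_⟩
  · rw [Real.coe_toNNReal _ (by positivity), Real.dist_eq]
    exact hFlip y z
  intro x₀ hx₀ D hD
  have hev := Metric.tendsto_nhds.mp hD η hη
  rw [eventually_nhdsWithin_iff, Metric.eventually_nhds_iff] at hev
  obtain ⟨δ, hδ, hD'⟩ := hev
  have hD2 : ∀ y, 0 < dist y x₀ → dist y x₀ < δ →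
      |F y - F x₀ - euclDot D (φ y - φ x₀)| ≤ η * dist y x₀ := by
    intro y hy0 hy
    have := hD' hy (dist_pos.mp hy0)
    rw [Real.dist_eq, sub_zero, abs_div, abs_abs, abs_of_pos hy0, div_lt_iff₀ hy0] at this
    exact this.le
  obtain ⟨k, hkδ, hkM⟩ := ((hεlim.eventually (gt_mem_nhds hδ)).and
    (eventually_ge_atTop (M x₀))).exists
  have hTd : ∀ y, |T (k + 1) y - T (k + 1) x₀| ≤ η * r k := by
    intro y
    have c1 := abs_le.mp (hTle (k + 1) y)
    have c2 := abs_le.mp (hTle (k + 1) x₀)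
    have := hε4r k
    rw [abs_le]
    constructor <;> linarith [c1.1, c1.2, c2.1, c2.2]
  have hεj : ∀ j < k, ε k ≤ ρ j := by
    intro j hj
    have := hεanti (show j + 1 ≤ k by omega)
    linarith [hε4ρ j, hρ0 j]
  -- lower bound on the norm of D
  have lower' : β / 2 - 3 * η ≤ ‖D‖ * K := by
    obtain ⟨x, hx0, hx1, hx2⟩ := gwit k x₀ hx₀ hkM
    have hxρ : ρ k ≤ dist x x₀ := by
      by_contra hcon
      push Not at hcon
      have := gflat k x₀ hx₀ x (mem_ball.mpr hcon) x₀ (mem_ball_self (hρ0 k))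
      have hp : (1 / 2 : ℝ) ^ (k + 1) ≤ 1 := pow_le_one₀ (by norm_num) (by norm_num)
      have : β / 2 * dist x x₀ ≤ η * dist x x₀ := by
        refine (hx2.trans this).trans ?_
        gcongr
        nlinarith
      nlinarith
    have b1 := hQflat k x₀ hx₀ x x₀ (fun j hj => mem_ball.mpr (hx1.trans_le (hεj j hj)))
      (fun j hj => mem_ball_self (hρ0 j))
    have b2 : |T (k + 1) x - T (k + 1) x₀| ≤ η * dist x x₀ :=
      (hTd x).trans (by have := hrρ k; gcongr; linarith)
    have b3 := hD2 x hx0 (hx1.trans hkδ)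
    have b4 : |euclDot D (φ x - φ x₀)| ≤ ‖D‖ * K * dist x x₀ := by
      refine (abs_euclDot_le _ _).trans ?_
      rw [mul_assoc]
      exact mul_le_mul_of_nonneg_left (hφ x x₀) (norm_nonneg D)
    have b5 : |g k x - g k x₀| ≤ |F x - F x₀ - euclDot D (φ x - φ x₀)|
        + |euclDot D (φ x - φ x₀)| + |Q k x - Q k x₀| + |T (k + 1) x - T (k + 1) x₀| := by
      rw [hF (k + 1) x, hF (k + 1) x₀, hQs, hQs]
      have := abs_add_three ((Q k x + g k x + T (k + 1) x) - (Q k x₀ + g k x₀ + T (k + 1) x₀)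
        - euclDot D (φ x - φ x₀)) (euclDot D (φ x - φ x₀))
        (-(Q k x - Q k x₀) + -(T (k + 1) x - T (k + 1) x₀))
      have t2 := abs_add_le (-(Q k x - Q k x₀)) (-(T (k + 1) x - T (k + 1) x₀))
      rw [abs_neg, abs_neg] at t2
      calc |g k x - g k x₀| = _ := by congr 1; ring
        _ ≤ _ := this
        _ ≤ _ := by linarith
    have b6 : (β / 2 - 3 * η) * dist x x₀ ≤ ‖D‖ * K * dist x x₀ := by linarith
    exact le_of_mul_le_mul_right b6 hx0
  have hDne : 0 < ‖D‖ := by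
    rcases (norm_nonneg D).eq_or_lt with h0 | h0
    · rw [← h0] at lower'; linarith
    · exact h0
  have upper : lam * ‖D‖ ≤ 3 * η := by
    obtain ⟨y, hy1, hy2, hy3⟩ := ggood k x₀ hx₀ (‖D‖⁻¹ • D) (by
      rw [norm_smul, norm_inv, norm_norm, inv_mul_cancel₀ hDne.ne'])
    have hy0 : 0 < dist y x₀ := (hr0 k).trans hy1
    have b1 := hQflat (k + 1) x₀ hx₀ y x₀
      (fun j hj => mem_ball.mpr (hy2.trans_le (hρanti (by omega))))
      (fun j hj => mem_ball_self (hρ0 j))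
    have b2 : |T (k + 1) y - T (k + 1) x₀| ≤ η * dist y x₀ :=
      (hTd y).trans (by gcongr)
    have b3 := hD2 y hy0 (by linarith [hρε k])
    rw [euclDot_smul_left', abs_mul, abs_of_pos (inv_pos.mpr hDne)] at hy3
    have b4 : lam * ‖D‖ * dist y x₀ ≤ |euclDot D (φ y - φ x₀)| := by
      have := mul_le_mul_of_nonneg_left hy3 hDne.le
      rw [mul_inv_cancel_left₀ hDne.ne'] at this
      linarith
    have b5 : |euclDot D (φ y - φ x₀)| ≤ |F y - F x₀ - euclDot D (φ y - φ x₀)|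
        + |Q (k + 1) y - Q (k + 1) x₀| + |T (k + 1) y - T (k + 1) x₀| := by
      rw [hF (k + 1) y, hF (k + 1) x₀]
      have := abs_add_three (-((Q (k + 1) y + T (k + 1) y) - (Q (k + 1) x₀ + T (k + 1) x₀)
        - euclDot D (φ y - φ x₀))) (Q (k + 1) y - Q (k + 1) x₀) (T (k + 1) y - T (k + 1) x₀)
      rw [abs_neg] at this
      calc |euclDot D (φ y - φ x₀)| = _ := by congr 1; ring
        _ ≤ _ := this
    have b6 : lam * ‖D‖ * dist y x₀ ≤ 3 * η * dist y x₀ := by linarith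
    exact le_of_mul_le_mul_right b6 hy0
  have hfin : ‖D‖ * K ≤ 3 * η * (K / lam) := by
    have : ‖D‖ ≤ 3 * η / lam := by rw [le_div_iff₀ hlam]; linarith
    calc ‖D‖ * K ≤ 3 * η / lam * K := by gcongr
      _ = _ := by ring
  nlinarith

/-- The core construction, without the Cauchy assumption. -/
lemma core_construction' {X : Type*} [MetricSpace X] [TopologicalSpace.SeparableSpace X]
    (U : Set X) (hU : IsCompact U) (S : Set X) (hSU : S ⊆ U)
    (L β : ℝ) (hL : 0 < L) (hβ : 0 < β)
    (f : ℕ → X → ℝ) (hf : ∀ m, LipschitzWith (Real.toNNReal L) (f m))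
    (h1 : ∀ x₀ ∈ S, ∃ M : ℕ, ∀ m : ℕ, M ≤ m → ∃ x : X,
      0 < dist x x₀ ∧ dist x x₀ < 1 / (m : ℝ) ∧ β * dist x x₀ ≤ |f m x - f m x₀|)
    (h2 : ∀ m : ℕ, 0 < m → ∃ ρ : ℝ, 0 < ρ ∧ ∀ x₀ ∈ S, ∀ y ∈ ball x₀ ρ, ∀ z ∈ ball x₀ ρ,
      |f m y - f m z| ≤ dist y z / (m : ℝ))
    {n : ℕ} (φ : X → EuclideanSpace ℝ (Fin n)) (K : ℝ≥0)
    (hφ : LipschitzWith K φ) (lam : ℝ) (hlam : 0 < lam)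
    (hgood : ∀ R : ℝ, 0 < R → ∃ r : ℝ, 0 < r ∧ ∀ x ∈ S, GoodAt φ lam R r x) :
    ∃ F : X → ℝ, (∃ C : ℝ≥0, LipschitzWith C F) ∧ ∀ x ∈ S, ∀ D, ¬ DiffAt F φ x D := by
  rcases S.eq_empty_or_nonempty with rfl | ⟨p, hp⟩
  · exact ⟨fun _ => 0, ⟨0, LipschitzWith.const 0⟩, by simp⟩
  have hf' : ∀ m y z, |f m y - f m z| ≤ L * dist y z := by
    intro m y z
    have := (hf m).dist_le_mul y z
    rwa [Real.dist_eq, Real.coe_toNNReal _ hL.le] at this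
  obtain ⟨ψ, hψ, hC⟩ := exists_cauchy_subseq U hU p L hL f hf'
  choose! M hM using h1
  refine core_construction S L β hL hβ (fun m x => f (ψ m) x - f (ψ m) p) ?_ ?_
    (fun x => max 1 (M x)) ?_ ?_
    φ K K.2 ?_ lam hlam hgood
  · intro m y z
    simpa using hf' (ψ m) y z
  · intro ε hε
    obtain ⟨N, hN⟩ := hC ε hε
    exact ⟨N, fun m hm m' hm' x hx => hN m hm m' hm' x (hSU hx)⟩
  · intro x₀ hx₀ m hm
    have hm1 : 1 ≤ m := (le_max_left _ _).trans hm
    have hid := hψ.id_le m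
    simp only [id] at hid
    obtain ⟨x, q1, q2, q3⟩ := hM x₀ hx₀ (ψ m) (((le_max_right _ _).trans hm).trans hid)
    refine ⟨x, q1, q2.trans_le ?_, by simpa using q3⟩
    have : (0 : ℝ) < m := by exact_mod_cast hm1
    have : (m : ℝ) ≤ ψ m := by exact_mod_cast hid
    gcongr
  · intro m hm
    have hid := hψ.id_le m
    simp only [id] at hid
    obtain ⟨ρ, hρ, q⟩ := h2 (ψ m) (by omega)
    refine ⟨ρ, hρ, fun x₀ hx₀ y hy z hz => ?_⟩
    have := q x₀ hx₀ y hy z hz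
    have h0 : (0 : ℝ) < m := by exact_mod_cast hm
    have h0' : (m : ℝ) ≤ ψ m := by exact_mod_cast hid
    have h3 : dist y z / (ψ m : ℝ) ≤ dist y z / m := by gcongr
    have h4 : f (ψ m) y - f (ψ m) p - (f (ψ m) z - f (ψ m) p) = f (ψ m) y - f (ψ m) z := by ring
    rw [h4]
    exact this.trans h3
  · intro y z
    rw [← dist_eq_norm]
    exact hφ.dist_le_mul y z

lemma good_of_structured {X : Type*} [MetricSpace X] {n : ℕ} (φ : X → EuclideanSpace ℝ (Fin n))
    (lam R r : ℝ) (hr : 0 < r) (x₀ : X) (x : Fin n → X)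
    (hx : ∀ i, r < dist (x i) x₀ ∧ dist (x i) x₀ < R)
    (hv : ∀ v : EuclideanSpace ℝ (Fin n), ‖v‖ = 1 →
        lam ≤ ⨆ i : Fin n, |euclDot (φ (x i) - φ x₀) v| / dist (x i) x₀) :
    GoodAt φ lam R r x₀ := by
  intro v hv1
  have hne : Nonempty (Fin n) := by
    by_contra hcon
    rw [not_nonempty_iff] at hcon
    have : v = 0 := Subsingleton.elim _ _
    simp [this] at hv1
  obtain ⟨i, hi⟩ := exists_eq_ciSup_of_finite
    (f := fun i : Fin n => |euclDot (φ (x i) - φ x₀) v| / dist (x i) x₀)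
  refine ⟨x i, (hx i).1, (hx i).2, ?_⟩
  have := hv v hv1
  rw [← hi] at this
  rw [le_div_iff₀ (hr.trans (hx i).1)] at this
  rwa [euclDot_eq_inner, real_inner_comm, ← euclDot_eq_inner]

lemma GoodAt.mono {X : Type*} [MetricSpace X] {n : ℕ} {φ : X → EuclideanSpace ℝ (Fin n)}
    {lam R r R' r' : ℝ} {x : X} (h : GoodAt φ lam R r x) (hR : R ≤ R') (hr : r' ≤ r) :
    GoodAt φ lam R' r' x := by
  intro v hv
  obtain ⟨y, h1, h2, h3⟩ := h v hv
  exact ⟨y, by linarith, by linarith, h3⟩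

lemma GoodAt.perturb {X : Type*} [MetricSpace X] {n : ℕ} {φ : X → EuclideanSpace ℝ (Fin n)}
    {K : ℝ≥0} (hφ : LipschitzWith K φ)
    {lam R r : ℝ} (hlam : 0 < lam) (hr : 0 < r) {x z : X} (h : GoodAt φ lam R r x)
    (hz : dist z x < lam * r / (2 * (2 * K + lam))) :
    GoodAt φ (lam / 2) (2 * R) (r / 2) z := by
  intro v hv
  obtain ⟨y, h1, h2, h3⟩ := h v hv
  have hK : (0 : ℝ) ≤ K := K.2
  rw [lt_div_iff₀ (by positivity)] at hz
  have hd := dist_nonneg (x := z) (y := x)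
  have hzr : dist z x < r / 2 := by nlinarith [mul_nonneg hd hK]
  have t1 := dist_triangle y z x
  have t2 := dist_triangle_right y z x
  refine ⟨y, by linarith, by linarith, ?_⟩
  have e : φ y - φ x = (φ y - φ z) + (φ z - φ x) := by abel
  have e1 : euclDot v (φ y - φ x) = euclDot v (φ y - φ z) + euclDot v (φ z - φ x) := by
    rw [e]; simp only [euclDot_eq_inner, inner_add_left]
  have e2 : |euclDot v (φ z - φ x)| ≤ K * dist z x := by
    refine (abs_euclDot_le _ _).trans ?_
    rw [hv, one_mul, ← dist_eq_norm]
    exact hφ.dist_le_mul z x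
  rw [e1] at h3
  have e3 := abs_add_le (euclDot v (φ y - φ z)) (euclDot v (φ z - φ x))
  nlinarith

lemma dot_perturb {X : Type*} [MetricSpace X] {n : ℕ} {φ : X → EuclideanSpace ℝ (Fin n)}
    {K : ℝ≥0} (hφ : LipschitzWith K φ) {c : ℝ} (hc : 0 < c) {x y : X}
    {v w : EuclideanSpace ℝ (Fin n)}
    (hw : dist w v < c / (2 * (K + 1))) (h : c * dist y x ≤ |euclDot v (φ y - φ x)|) :
    c / 2 * dist y x ≤ |euclDot w (φ y - φ x)| := by
  have hK : (0 : ℝ) ≤ K := K.2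
  have hd := dist_nonneg (x := y) (y := x)
  have e1 : |euclDot (w - v) (φ y - φ x)| ≤ c / 2 * dist y x := by
    refine (abs_euclDot_le _ _).trans ?_
    rw [← dist_eq_norm, ← dist_eq_norm]
    have a := hφ.dist_le_mul y x
    calc dist w v * dist (φ y) (φ x) ≤ c / (2 * (K + 1)) * (K * dist y x) := by gcongr
      _ ≤ c / (2 * (K + 1)) * ((K + 1) * dist y x) := by gcongr; linarith
      _ = _ := by field_simp
  rw [euclDot_sub_left'] at e1
  have := abs_sub_abs_le_abs_sub (euclDot v (φ y - φ x)) (euclDot w (φ y - φ x))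
  rw [abs_sub_comm] at this
  linarith

/-- Uniqueness of derivatives implies quantitative non-degeneracy of the chart. -/
lemma good_of_unique {X : Type*} [MetricSpace X] {n : ℕ} {φ : X → EuclideanSpace ℝ (Fin n)}
    {K : ℝ≥0} (hφ : LipschitzWith K φ) (x : X) (hx : ∃! D, DiffAt (fun _ => 0) φ x D) :
    ∃ lam > 0, ∀ R > 0, ∃ r > 0, GoodAt φ lam R r x := by
  have h0 : DiffAt (fun _ => 0) φ x 0 := by
    simp only [DiffAt, euclDot]
    simpa using tendsto_const_nhds
  have hpt : ∀ v : EuclideanSpace ℝ (Fin n), ‖v‖ = 1 → ∃ c > 0, ∀ R > 0, ∃ y,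
      0 < dist y x ∧ dist y x < R ∧ c * dist y x ≤ |euclDot v (φ y - φ x)| := by
    intro v hv
    by_contra! hcon
    have hvD : DiffAt (fun _ => 0) φ x v := by
      refine Metric.tendsto_nhds.mpr fun c hc => ?_
      rw [eventually_nhdsWithin_iff, Metric.eventually_nhds_iff]
      obtain ⟨R, hR, hR'⟩ := hcon c hc
      refine ⟨R, hR, fun y hy hyx => ?_⟩
      have hd : 0 < dist y x := dist_pos.mpr hyx
      have := hR' y hd hy
      rw [Real.dist_eq, sub_zero, abs_div, abs_abs, abs_of_pos hd, div_lt_iff₀ hd]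
      simpa using this
    have := hx.unique hvD h0
    simp [this] at hv
  have hcomp : IsCompact (sphere (0 : EuclideanSpace ℝ (Fin n)) 1) := isCompact_sphere 0 1
  have hK : (0 : ℝ) ≤ K := K.2
  have s1 : ∃ c > 0, ∀ v ∈ sphere (0 : EuclideanSpace ℝ (Fin n)) 1, ∀ R > 0, ∃ y,
      0 < dist y x ∧ dist y x < R ∧ c * dist y x ≤ |euclDot v (φ y - φ x)| := by
    refine hcomp.induction_on (p := fun s => ∃ c > 0, ∀ v ∈ s, ∀ R > 0, ∃ y,
      0 < dist y x ∧ dist y x < R ∧ c * dist y x ≤ |euclDot v (φ y - φ x)|) ?_ ?_ ?_ ?_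
    · exact ⟨1, one_pos, by simp⟩
    · rintro s t hst ⟨c, hc, h⟩
      exact ⟨c, hc, fun v hv => h v (hst hv)⟩
    · rintro s t ⟨c, hc, h⟩ ⟨c', hc', h'⟩
      refine ⟨min c c', lt_min hc hc', ?_⟩
      rintro v (hv | hv) R hR
      · obtain ⟨y, q1, q2, q3⟩ := h v hv R hR
        exact ⟨y, q1, q2, le_trans (by gcongr; exact min_le_left _ _) q3⟩
      · obtain ⟨y, q1, q2, q3⟩ := h' v hv R hR
        exact ⟨y, q1, q2, le_trans (by gcongr; exact min_le_right _ _) q3⟩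
    · intro v hv
      obtain ⟨c, hc, h⟩ := hpt v (by simpa using hv)
      refine ⟨ball v (c / (2 * (K + 1))), mem_nhdsWithin_of_mem_nhds
        (ball_mem_nhds _ (by positivity)), c / 2, by positivity, fun w hw R hR => ?_⟩
      obtain ⟨y, q1, q2, q3⟩ := h R hR
      exact ⟨y, q1, q2, dot_perturb hφ hc (mem_ball.mp hw) q3⟩
  obtain ⟨c, hc, hs1⟩ := s1
  refine ⟨c / 2, by positivity, fun R hR => ?_⟩
  have s2 : ∃ r > 0, ∀ v ∈ sphere (0 : EuclideanSpace ℝ (Fin n)) 1, ∃ y,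
      r < dist y x ∧ dist y x < R ∧ c / 2 * dist y x ≤ |euclDot v (φ y - φ x)| := by
    refine hcomp.induction_on (p := fun s => ∃ r > 0, ∀ v ∈ s, ∃ y,
      r < dist y x ∧ dist y x < R ∧ c / 2 * dist y x ≤ |euclDot v (φ y - φ x)|) ?_ ?_ ?_ ?_
    · exact ⟨1, one_pos, by simp⟩
    · rintro s t hst ⟨c, hc, h⟩
      exact ⟨c, hc, fun v hv => h v (hst hv)⟩
    · rintro s t ⟨c, hc, h⟩ ⟨c', hc', h'⟩
      refine ⟨min c c', lt_min hc hc', ?_⟩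
      rintro v (hv | hv)
      · obtain ⟨y, q1, q2⟩ := h v hv
        exact ⟨y, lt_of_le_of_lt (min_le_left _ _) q1, q2⟩
      · obtain ⟨y, q1, q2⟩ := h' v hv
        exact ⟨y, lt_of_le_of_lt (min_le_right _ _) q1, q2⟩
    · intro v hv
      obtain ⟨y, q1, q2, q3⟩ := hs1 v hv R hR
      refine ⟨ball v (c / (2 * (K + 1))), mem_nhdsWithin_of_mem_nhds
        (ball_mem_nhds _ (by positivity)), dist y x / 2, by positivity, fun w hw => ?_⟩
      exact ⟨y, by linarith, q2, dot_perturb hφ hc (mem_ball.mp hw) q3⟩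
  obtain ⟨r, hr, hs2⟩ := s2
  exact ⟨r, hr, fun v hv => hs2 v (by simpa using hv)⟩

/-- From pointwise to uniform scales, up to small measure. -/
lemma measure_zero_of_uniform {X : Type*} [MetricSpace X]
    [MeasurableSpace X] [BorelSpace X] (μ : Measure X) [IsFiniteMeasure μ]
    {n : ℕ} (φ : X → EuclideanSpace ℝ (Fin n)) (K : ℝ≥0) (hφ : LipschitzWith K φ)
    (E : Set X) (hE : MeasurableSet E)
    (hpt : ∀ x ∈ E, ∃ lam > 0, ∀ R > 0, ∃ r > 0, GoodAt φ lam R r x)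
    (hunif : ∀ E' ⊆ E, ∀ lam > 0,
      (∀ R : ℝ, 0 < R → ∃ r : ℝ, 0 < r ∧ ∀ x ∈ E', GoodAt φ lam R r x) → μ E' = 0) :
    μ E = 0 := by
  let a : ℕ → ℝ := fun N => 1 / ((N : ℝ) + 1)
  have ha : ∀ N, 0 < a N := fun N => by positivity
  have haex : ∀ c > 0, ∃ N, a N < c := fun c hc => exists_nat_one_div_lt hc
  have haanti : ∀ i j, i ≤ j → a j ≤ a i := fun i j hij => by
    simp only [a]; gcongr
  let O : ℕ → ℕ → ℕ → Set X := fun N j l =>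
    thickening (a N * a l / (2 * (2 * K + a N))) {x | GoodAt φ (a N) (a j) (a l) x}
  have hOopen : ∀ N j l, IsOpen (O N j l) := fun N j l => isOpen_thickening
  have hOgood : ∀ N j l, ∀ x ∈ O N j l, GoodAt φ (a N / 2) (2 * a j) (a l / 2) x := by
    intro N j l x hx
    obtain ⟨z, hz, hxz⟩ := mem_thickening_iff.mp hx
    exact GoodAt.perturb hφ (ha N) (ha l) hz hxz
  have hcover : E ⊆ ⋃ N, E ∩ ⋂ j, ⋃ l, O N j l := by
    intro x hx
    obtain ⟨lam, hlam, h⟩ := hpt x hx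
    obtain ⟨N, hN⟩ := haex lam hlam
    refine mem_iUnion.mpr ⟨N, hx, mem_iInter.mpr fun j => ?_⟩
    obtain ⟨r, hr, hg⟩ := h (a j) (ha j)
    obtain ⟨l, hl⟩ := haex r hr
    refine mem_iUnion.mpr ⟨l, self_subset_thickening ?_ _ ?_⟩
    · have := ha N; have := ha l; have : (0 : ℝ) ≤ K := K.2; positivity
    · intro v hv
      obtain ⟨y, q1, q2, q3⟩ := hg v hv
      exact ⟨y, by linarith, q2, le_trans (by gcongr) q3⟩
  refine measure_mono_null hcover (measure_iUnion_null fun N => ?_)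
  set A := E ∩ ⋂ j, ⋃ l, O N j l with hA
  have hAm : MeasurableSet A :=
    hE.inter (MeasurableSet.iInter fun j => MeasurableSet.iUnion fun l => (hOopen N j l).measurableSet)
  have hsmall : ∀ j, ∀ ε : ℝ≥0∞, 0 < ε → ∃ k, μ (A \ ⋃ l ≤ k, O N j l) < ε := by
    intro j ε hε
    have hlim : Tendsto (fun k => μ (A \ ⋃ l ≤ k, O N j l)) atTop
        (𝓝 (μ (⋂ k, A \ ⋃ l ≤ k, O N j l))) := by
      refine tendsto_measure_iInter_atTop (fun k => ?_) ?_ ⟨0, measure_ne_top _ _⟩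
      · exact (hAm.diff (MeasurableSet.iUnion fun l => MeasurableSet.iUnion fun _ =>
          (hOopen N j l).measurableSet)).nullMeasurableSet
      · intro k k' hkk'
        refine sdiff_subset_sdiff_right ?_
        exact biUnion_subset_biUnion_left fun l hl => le_trans hl hkk'
    have hemp : (⋂ k, A \ ⋃ l ≤ k, O N j l) = ∅ := by
      rw [eq_empty_iff_forall_notMem]
      intro x hx
      rw [mem_iInter] at hx
      obtain ⟨l, hl⟩ := mem_iUnion.mp (mem_iInter.mp (hx 0).1.2 j)
      exact (hx l).2 (mem_biUnion (le_refl l) hl)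
    rw [hemp, measure_empty] at hlim
    exact (hlim.eventually (gt_mem_nhds hε)).exists
  by_contra hpos
  obtain ⟨ε', hε'0, hε'⟩ := ENNReal.exists_pos_sum_of_countable' hpos ℕ
  choose k hk using fun j => hsmall j (ε' j) (hε'0 j)
  set E' := A ∩ ⋂ j, ⋃ l ≤ k j, O N j l with hE'
  have hz : μ E' = 0 := by
    refine hunif E' (fun x hx => hx.1.1) (a N / 2) (by have := ha N; positivity) fun R hR => ?_
    obtain ⟨j, hj⟩ := haex (R / 2) (by positivity)
    refine ⟨a (k j) / 2, by have := ha (k j); positivity, fun x hx => ?_⟩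
    have := mem_iInter.mp hx.2 j
    simp only [mem_iUnion] at this
    obtain ⟨l, hl, hxl⟩ := this
    refine (hOgood N j l x hxl).mono (by linarith) ?_
    have := haanti l (k j) hl
    linarith
  have hsub : A ⊆ E' ∪ ⋃ j, (A \ ⋃ l ≤ k j, O N j l) := by
    intro x hx
    by_cases hx' : x ∈ ⋂ j, ⋃ l ≤ k j, O N j l
    · exact Or.inl ⟨hx, hx'⟩
    · rw [mem_iInter] at hx'
      push Not at hx'
      obtain ⟨j, hj⟩ := hx'
      exact Or.inr (mem_iUnion.mpr ⟨j, hx, hj⟩)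
  have : μ A < μ A := calc
    μ A ≤ μ E' + μ (⋃ j, (A \ ⋃ l ≤ k j, O N j l)) :=
        (measure_mono hsub).trans (measure_union_le _ _)
    _ = μ (⋃ j, (A \ ⋃ l ≤ k j, O N j l)) := by rw [hz, zero_add]
    _ ≤ ∑' j, μ (A \ ⋃ l ≤ k j, O N j l) := measure_iUnion_le _
    _ ≤ ∑' j, ε' j := ENNReal.tsum_le_tsum fun j => (hk j).le
    _ < μ A := hε'
  exact lt_irrefl _ this

/-- **Construction of a non-differentiable Lipschitz function.**  Let `(U,φ)` be a structured
chart in a metric measure space `(X,d,μ)`, `S ⊆ U` Borel and `L, β > 0`.  Suppose there is a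
sequence of `L`-Lipschitz functions `fₘ : X → ℝ` such that:
(1) for every `x₀ ∈ S` there is `M` such that for all `m ≥ M` there is `x` with
`0 < d(x,x₀) < 1/m` and `|fₘ(x)-fₘ(x₀)| ≥ β d(x,x₀)`; and
(2) for every `m ≥ 1` there is `ρₘ > 0` such that `|fₘ(y)-fₘ(z)| ≤ d(y,z)/m` for every
`x₀ ∈ S` and `y,z ∈ B(x₀,ρₘ)`.
Then there is a Lipschitz `F : X → ℝ` differentiable with respect to `(U,φ)` at almost no
point of `S`; in particular if `(X,d,μ)` is a Lipschitz differentiability space then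
`μ(S) = 0`. -/
theorem nondifferentiable_construction
    {X : Type*} [MetricSpace X] [CompleteSpace X] [TopologicalSpace.SeparableSpace X]
    [MeasurableSpace X] [BorelSpace X] (μ : Measure X) [IsFiniteMeasure μ]
    (hiso : μ {x : X | 𝓝[≠] x = ⊥} = 0)
    {n : ℕ} (U : Set X) (φ : X → EuclideanSpace ℝ (Fin n))
    (hφ : ∃ K : ℝ≥0, LipschitzWith K φ)
    (hchart : ∃ lam : ℝ, 0 < lam ∧ IsStructuredChartWith μ U φ lam)
    (S : Set X) (hS : MeasurableSet S) (hSU : S ⊆ U)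
    (L β : ℝ) (hL : 0 < L) (hβ : 0 < β)
    (f : ℕ → X → ℝ) (hf : ∀ m, LipschitzWith (Real.toNNReal L) (f m))
    (h1 : ∀ x₀ ∈ S, ∃ M : ℕ, ∀ m : ℕ, M ≤ m → ∃ x : X,
      0 < dist x x₀ ∧ dist x x₀ < 1 / (m : ℝ) ∧ β * dist x x₀ ≤ |f m x - f m x₀|)
    (h2 : ∀ m : ℕ, 0 < m → ∃ ρ : ℝ, 0 < ρ ∧ ∀ x₀ ∈ S, ∀ y ∈ ball x₀ ρ, ∀ z ∈ ball x₀ ρ,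
      |f m y - f m z| ≤ dist y z / (m : ℝ)) :
    (∃ F : X → ℝ, (∃ K : ℝ≥0, LipschitzWith K F) ∧
      ∀ᵐ x ∂(μ.restrict S), ¬ ∃! D, DiffAt F φ x D) ∧
    (IsLDS X μ → μ S = 0) := by
  obtain ⟨Kφ, hKφ⟩ := hφ
  obtain ⟨lam, hlam, hUc, U', hU'U, hU'0, hU'⟩ := hchart
  have core : ∀ S' ⊆ S, ∀ {n' : ℕ} (φ' : X → EuclideanSpace ℝ (Fin n')) (K : ℝ≥0),
      LipschitzWith K φ' → ∀ lam : ℝ, 0 < lam →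
      (∀ R : ℝ, 0 < R → ∃ r : ℝ, 0 < r ∧ ∀ x ∈ S', GoodAt φ' lam R r x) →
      ∃ F : X → ℝ, (∃ C : ℝ≥0, LipschitzWith C F) ∧ ∀ x ∈ S', ∀ D, ¬ DiffAt F φ' x D := by
    intro S' hS' n' φ' K hφ' lam hlam hgood
    refine core_construction' U hUc S' (hS'.trans hSU) L β hL hβ f hf
      (fun x hx => h1 x (hS' hx)) (fun m hm => ?_) φ' K hφ' lam hlam hgood
    obtain ⟨ρ, hρ, q⟩ := h2 m hm
    exact ⟨ρ, hρ, fun x hx => q x (hS' hx)⟩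
  constructor
  · obtain ⟨F, hF, hFD⟩ := core (S ∩ U') inter_subset_left φ Kφ hKφ lam hlam (by
      intro R hR
      obtain ⟨r, hr, q⟩ := hU' R hR
      refine ⟨r, hr, fun x₀ hx₀ => ?_⟩
      obtain ⟨x, hx, hv⟩ := q x₀ hx₀.2
      exact good_of_structured φ lam R r hr x₀ x (fun i => (hx i).2) hv)
    refine ⟨F, hF, ?_⟩
    rw [ae_restrict_iff' hS]
    have : ∀ᵐ x ∂μ, x ∉ U \ U' := measure_eq_zero_iff_ae_notMem.mp hU'0
    filter_upwards [this] with x hx hxS hD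
    have hxU' : x ∈ U' := by
      by_contra hcon
      exact hx ⟨hSU hxS, hcon⟩
    obtain ⟨D, hD, -⟩ := hD
    exact hFD x ⟨hxS, hxU'⟩ D hD
  · rintro ⟨n', V, φ', hVm, hVu, hφ', hdiff⟩
    have hcov : S ⊆ ⋃ i, S ∩ V i := by
      rw [← inter_iUnion, hVu, inter_univ]
    refine measure_mono_null hcov (measure_iUnion_null fun i => ?_)
    obtain ⟨K, hK⟩ := hφ' i
    have h0 := hdiff (fun _ => 0) ⟨0, LipschitzWith.const 0⟩ i
    rw [ae_restrict_iff' (hVm i)] at h0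
    obtain ⟨Z, hZsub, hZm, hZ0⟩ := exists_measurable_superset_of_null (ae_iff.mp h0)
    have hE : μ ((S ∩ V i) \ Z) = 0 := by
      refine measure_zero_of_uniform μ (φ' i) K hK _ ((hS.inter (hVm i)).diff hZm) ?_ ?_
      · intro x hx
        refine good_of_unique hK x ?_
        by_contra hcon
        exact hx.2 (hZsub (fun h => hcon (h hx.1.2)))
      · intro E' hE' lam hlam hgood
        obtain ⟨F, hF, hFD⟩ := core E' (fun x hx => (hE' hx).1.1) (φ' i) K hK lam hlam hgood
        have h3 := hdiff F hF i
        rw [ae_restrict_iff' (hVm i)] at h3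
        refine measure_mono_null ?_ (ae_iff.mp h3)
        intro x hx hcon
        obtain ⟨D, hD, -⟩ := hcon (hE' hx).1.2
        exact hFD x hx D hD
    refine measure_mono_null (t := ((S ∩ V i) \ Z) ∪ Z) (fun x hx => ?_) (measure_union_null hE hZ0)
    by_cases hxZ : x ∈ Z
    · exact Or.inr hxZ
    · exact Or.inl ⟨hx, hxZ⟩
end
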